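/- arXiv:2506.17704 — 3 statements merged into one kernel-verified Lean document; each statement's English description precedes it below -/
import Mathlib

section
/- T_{max,2}(12) = 54 and T_{max,3}(12) = 66; in particular, for l = 12 the function m1 ↦ T_{max,m1}(12) is strictly increasing on {1, 2, 3}. -/
open MvPolynomial

/-- A monomial ideal: an ideal containing the monomials of all its elements. -/
def IsMonomialIdeal (I : Ideal (MvPolynomial (Fin 3) ℂ)) : Prop :=
  ∀ p ∈ I, ∀ d ∈ p.support, (monomial d (1 : ℂ)) ∈ I

/-- Borel-fixed (strongly stable) in characteristic 0: for every monomial in `I`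
divisible by `x_j`, and every `i < j`, replacing one factor `x_j` by `x_i`
stays in `I`. -/
def IsBorelFixed (I : Ideal (MvPolynomial (Fin 3) ℂ)) : Prop :=
  ∀ d : Fin 3 →₀ ℕ, (monomial d (1 : ℂ)) ∈ I →
    ∀ i j : Fin 3, i < j → 0 < d j →
      (monomial (d + Finsupp.single i 1 - Finsupp.single j 1) (1 : ℂ)) ∈ I

/-- The dimension of the tangent space to the Hilbert scheme at `[I]`,
namely `dim_ℂ Hom_R(I, R/I)`. -/
noncomputable def tangentDim (I : Ideal (MvPolynomial (Fin 3) ℂ)) : ℕ :=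
  Module.finrank ℂ (↥I →ₗ[MvPolynomial (Fin 3) ℂ] (MvPolynomial (Fin 3) ℂ ⧸ I))

/-- `TmaxEq l m1 T` says that `T` is the maximum of `dim_ℂ Hom_R(I, R/I)` over all
Borel-fixed monomial ideals `I ⊆ ℂ[x,y,z]` of colength `l` whose smallest pure power
of `x` lying in `I` is `x^{m1}`. -/
def TmaxEq (l m1 T : ℕ) : Prop :=
  IsGreatest { t : ℕ | ∃ I : Ideal (MvPolynomial (Fin 3) ℂ),
      IsMonomialIdeal I ∧ IsBorelFixed I ∧
      Module.finrank ℂ (MvPolynomial (Fin 3) ℂ ⧸ I) = l ∧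
      (X 0 : MvPolynomial (Fin 3) ℂ) ^ m1 ∈ I ∧
      (X 0 : MvPolynomial (Fin 3) ℂ) ^ (m1 - 1) ∉ I ∧
      t = tangentDim I } T

section MonomialIdeals

variable {I : Ideal (MvPolynomial (Fin 3) ℂ)}

/-- The coefficient of the standard monomial with exponent `s` on `R/I`
(junk value `0` if the monomial lies in `I`). -/
noncomputable def quotCoeff (I : Ideal (MvPolynomial (Fin 3) ℂ)) (s : Fin 3 →₀ ℕ) :
    (MvPolynomial (Fin 3) ℂ ⧸ I) →ₗ[ℂ] ℂ := by
  classical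
  exact if h : I.restrictScalars ℂ ≤ LinearMap.ker (lcoeff ℂ s) then
    ((I.restrictScalars ℂ).liftQ (lcoeff ℂ s) h).comp
      (Submodule.Quotient.restrictScalarsEquiv ℂ I).symm.toLinearMap
  else 0

lemma IsMonomialIdeal.coeff_eq_zero (hI : IsMonomialIdeal I) {s : Fin 3 →₀ ℕ}
    (hs : monomial s (1 : ℂ) ∉ I) {p : MvPolynomial (Fin 3) ℂ} (hp : p ∈ I) :
    coeff s p = 0 := by
  by_contra h
  exact hs (hI p hp s (mem_support_iff.2 h))

lemma quotCoeff_mk (hI : IsMonomialIdeal I) {s : Fin 3 →₀ ℕ}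
    (hs : monomial s (1 : ℂ) ∉ I) (p : MvPolynomial (Fin 3) ℂ) :
    quotCoeff I s (Ideal.Quotient.mk I p) = coeff s p := by
  have h : I.restrictScalars ℂ ≤ LinearMap.ker (lcoeff ℂ s) :=
    fun q hq => hI.coeff_eq_zero hs hq
  rw [quotCoeff, dif_pos h]
  rfl

lemma monomial_mem_of_le {m n : Fin 3 →₀ ℕ} (hm : monomial m (1 : ℂ) ∈ I) (h : m ≤ n)
    (c : ℂ) : monomial n c ∈ I := by
  have := I.mul_mem_left (monomial (n - m) c) hm
  rwa [monomial_mul, tsub_add_cancel_of_le h, mul_one] at this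

lemma quotCoeff_monomial_smul_add (hI : IsMonomialIdeal I) {s d : Fin 3 →₀ ℕ}
    (hs : monomial (s + d) (1 : ℂ) ∉ I) (v : MvPolynomial (Fin 3) ℂ ⧸ I) :
    quotCoeff I (s + d) (monomial d (1 : ℂ) • v) = quotCoeff I s v := by
  obtain ⟨p, rfl⟩ := Ideal.Quotient.mk_surjective v
  have hs' : monomial s (1 : ℂ) ∉ I :=
    fun h => hs (monomial_mem_of_le h le_self_add 1)
  rw [← Ideal.Quotient.mk_eq_mk, ← Submodule.Quotient.mk_smul, Ideal.Quotient.mk_eq_mk,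
    Ideal.Quotient.mk_eq_mk, quotCoeff_mk hI hs, quotCoeff_mk hI hs', smul_eq_mul,
    coeff_monomial_mul', if_pos le_add_self, add_tsub_cancel_right, one_mul]

lemma quotCoeff_monomial_smul_of_not_le (hI : IsMonomialIdeal I) {s d : Fin 3 →₀ ℕ}
    (hs : monomial s (1 : ℂ) ∉ I) (hd : ¬ d ≤ s) (v : MvPolynomial (Fin 3) ℂ ⧸ I) :
    quotCoeff I s (monomial d (1 : ℂ) • v) = 0 := by
  obtain ⟨p, rfl⟩ := Ideal.Quotient.mk_surjective v
  rw [← Ideal.Quotient.mk_eq_mk, ← Submodule.Quotient.mk_smul, Ideal.Quotient.mk_eq_mk,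
    quotCoeff_mk hI hs, smul_eq_mul, coeff_monomial_mul', if_neg hd]

lemma eq_zero_of_quotCoeff (hI : IsMonomialIdeal I) {v : MvPolynomial (Fin 3) ℂ ⧸ I}
    (hv : ∀ s, monomial s (1 : ℂ) ∉ I → quotCoeff I s v = 0) : v = 0 := by
  obtain ⟨p, rfl⟩ := Ideal.Quotient.mk_surjective v
  rw [Ideal.Quotient.eq_zero_iff_mem, p.as_sum]
  refine I.sum_mem fun s hs => ?_
  by_contra h
  have hs' : monomial s (1 : ℂ) ∉ I := fun h' => h (monomial_mem_of_le h' le_rfl _)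
  exact mem_support_iff.1 hs ((quotCoeff_mk hI hs' p).symm.trans (hv s hs'))

lemma IsMonomialIdeal.induction_on (hI : IsMonomialIdeal I)
    {P : MvPolynomial (Fin 3) ℂ → Prop} (h0 : P 0) (hadd : ∀ p q, P p → P q → P (p + q))
    (hmon : ∀ m, monomial m (1 : ℂ) ∈ I → ∀ c, P (monomial m c))
    {p : MvPolynomial (Fin 3) ℂ} (hp : p ∈ I) : P p := by
  rw [p.as_sum]
  exact Finset.sum_induction _ P hadd h0 fun m hm => hmon m (hI p hp m hm) _

lemma finrank_quotient_eq_card (hI : IsMonomialIdeal I) :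
    Module.finrank ℂ (MvPolynomial (Fin 3) ℂ ⧸ I) =
      Nat.card {s : Fin 3 →₀ ℕ // monomial s (1 : ℂ) ∉ I} := by
  classical
  let v : {s : Fin 3 →₀ ℕ // monomial s (1 : ℂ) ∉ I} → MvPolynomial (Fin 3) ℂ ⧸ I :=
    fun s => Ideal.Quotient.mk I (monomial s.1 1)
  have hli : LinearIndependent ℂ v := by
    rw [linearIndependent_iff]
    intro l hl
    ext s
    have h := congrArg (quotCoeff I s.1) hl
    rw [Finsupp.linearCombination_apply, Finsupp.sum, map_sum, map_zero] at h
    simp only [map_smul, v, quotCoeff_mk hI s.2, coeff_monomial, smul_eq_mul,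
      ← Subtype.ext_iff] at h
    simpa using h
  have hsp : ⊤ ≤ Submodule.span ℂ (Set.range v) := by
    rintro w -
    obtain ⟨p, rfl⟩ := Ideal.Quotient.mk_surjective w
    rw [p.as_sum, map_sum]
    refine Submodule.sum_mem _ fun s _ => ?_
    by_cases hs : monomial s (1 : ℂ) ∈ I
    · rw [Ideal.Quotient.eq_zero_iff_mem.2 (monomial_mem_of_le hs le_rfl _)]
      exact Submodule.zero_mem _
    · have : Ideal.Quotient.mk I (monomial s (coeff s p)) = coeff s p • v ⟨s, hs⟩ := by
        rw [← mul_one (coeff s p), ← smul_eq_mul, ← smul_monomial, smul_eq_mul, mul_one]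
        rfl
      rw [this]
      exact Submodule.smul_mem _ _ (Submodule.subset_span ⟨_, rfl⟩)
  exact Module.finrank_eq_nat_card_basis (Module.Basis.mk hli hsp)

/-- Evaluation of homomorphisms `I → R/I` at the coefficients listed in `P`. -/
noncomputable def homCoeffs (g : ℕ → Fin 3 →₀ ℕ) (hg : ∀ n, monomial (g n) (1 : ℂ) ∈ I)
    (P : Finset (ℕ × (Fin 3 →₀ ℕ))) :
    (↥I →ₗ[MvPolynomial (Fin 3) ℂ] (MvPolynomial (Fin 3) ℂ ⧸ I)) →ₗ[ℂ] (P → ℂ) where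
  toFun φ x := quotCoeff I x.1.2 (φ ⟨_, hg x.1.1⟩)
  map_add' φ ψ := by ext x; simp
  map_smul' c φ := by ext x; simp

variable {g : ℕ → Fin 3 →₀ ℕ} {N : ℕ} {P : Finset (ℕ × (Fin 3 →₀ ℕ))}

lemma homCoeffs_injective (hI : IsMonomialIdeal I)
    (hg : ∀ n, monomial (g n) (1 : ℂ) ∈ I)
    (hgen : ∀ m, monomial m (1 : ℂ) ∈ I → ∃ n < N, g n ≤ m)
    (hP : ∀ n < N, ∀ s, monomial s (1 : ℂ) ∉ I → (n, s) ∈ P ∨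
      ∃ j d e, g n + d = g j + e ∧ j < N ∧ monomial (s + d) (1 : ℂ) ∉ I ∧
        (j < n ∨ ¬ e ≤ s + d)) :
    Function.Injective (homCoeffs g hg P) := by
  rw [injective_iff_map_eq_zero]
  intro φ hφ
  have hmul : ∀ n d (h : monomial (g n + d) (1 : ℂ) ∈ I),
      φ ⟨_, h⟩ = monomial d (1 : ℂ) • φ ⟨_, hg n⟩ := by
    intro n d h
    rw [← map_smul]
    congr 1
    ext1
    simp [monomial_mul, add_comm]
  have hzero : ∀ n, n < N → ∀ s, monomial s (1 : ℂ) ∉ I →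
      quotCoeff I s (φ ⟨_, hg n⟩) = 0 := by
    intro n
    induction n using Nat.strong_induction_on with
    | _ n ih =>
      intro hn s hs
      rcases hP n hn s hs with h | ⟨j, d, e, heq, hj, hsd, h⟩
      · exact congrFun hφ ⟨_, h⟩
      · have hmem : monomial (g n + d) (1 : ℂ) ∈ I :=
          monomial_mem_of_le (hg n) le_self_add 1
        have hmem' : monomial (g j + e) (1 : ℂ) ∈ I := heq ▸ hmem
        have hval : φ ⟨_, hmem⟩ = φ ⟨_, hmem'⟩ := by
          congr 2
          rw [heq]
        rw [← quotCoeff_monomial_smul_add hI hsd, ← hmul n d hmem, hval, hmul j e hmem']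
        by_cases he : e ≤ s + d
        · obtain ⟨u, hu⟩ := exists_add_of_le he
          rw [add_comm e u] at hu
          rw [hu] at hsd ⊢
          rw [quotCoeff_monomial_smul_add hI hsd]
          exact ih j (h.resolve_right (not_not.2 he)) hj u
            fun h' => hsd (monomial_mem_of_le h' le_self_add 1)
        · exact quotCoeff_monomial_smul_of_not_le hI hsd he _
  have hgens : ∀ n < N, φ ⟨_, hg n⟩ = 0 :=
    fun n hn => eq_zero_of_quotCoeff hI (hzero n hn)
  have hall : ∀ p ∈ I, ∃ h : p ∈ I, φ ⟨p, h⟩ = 0 := by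
    intro p hp
    refine hI.induction_on (P := fun p => ∃ h : p ∈ I, φ ⟨p, h⟩ = 0)
      ⟨I.zero_mem, map_zero φ⟩ ?_ ?_ hp
    · rintro p q ⟨hp, hp0⟩ ⟨hq, hq0⟩
      refine ⟨I.add_mem hp hq, ?_⟩
      have : (⟨p + q, I.add_mem hp hq⟩ : I) = ⟨p, hp⟩ + ⟨q, hq⟩ := rfl
      rw [this, map_add, hp0, hq0, add_zero]
    · intro m hm c
      obtain ⟨n, hn, hle⟩ := hgen m hm
      refine ⟨monomial_mem_of_le hm le_rfl c, ?_⟩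
      have : (⟨monomial m c, monomial_mem_of_le hm le_rfl c⟩ : I) =
          monomial (m - g n) c • ⟨_, hg n⟩ := by
        ext1
        simp [monomial_mul, tsub_add_cancel_of_le hle]
      rw [this, map_smul, hgens n hn, smul_zero]
  ext x
  obtain ⟨h, h0⟩ := hall x.1 x.2
  exact h0

lemma tangentDim_le_card (hI : IsMonomialIdeal I)
    (hg : ∀ n, monomial (g n) (1 : ℂ) ∈ I)
    (hgen : ∀ m, monomial m (1 : ℂ) ∈ I → ∃ n < N, g n ≤ m)
    (hP : ∀ n < N, ∀ s, monomial s (1 : ℂ) ∉ I → (n, s) ∈ P ∨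
      ∃ j d e, g n + d = g j + e ∧ j < N ∧ monomial (s + d) (1 : ℂ) ∉ I ∧
        (j < n ∨ ¬ e ≤ s + d)) :
    tangentDim I ≤ P.card := by
  have := LinearMap.finrank_le_finrank_of_injective (homCoeffs_injective hI hg hgen hP)
  simpa [tangentDim] using this

/-- The `ℂ`-linear map sending `x^m` to the class of `x^(s + m - a)` if `a ≤ m`, and to
zero otherwise. -/
noncomputable def shiftMap (I : Ideal (MvPolynomial (Fin 3) ℂ)) (a s : Fin 3 →₀ ℕ) :
    MvPolynomial (Fin 3) ℂ →ₗ[ℂ] (MvPolynomial (Fin 3) ℂ ⧸ I) := by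
  classical
  exact (basisMonomials (Fin 3) ℂ).constr ℂ
    fun m => if a ≤ m then Ideal.Quotient.mk I (monomial (s + (m - a)) 1) else 0

lemma shiftMap_monomial_add (a s d : Fin 3 →₀ ℕ) (c : ℂ) :
    shiftMap I a s (monomial (a + d) c) = Ideal.Quotient.mk I (monomial (s + d) c) := by
  have h : (monomial (a + d) c : MvPolynomial (Fin 3) ℂ) =
      c • basisMonomials (Fin 3) ℂ (a + d) := by simp [smul_monomial]
  have h' : (monomial (s + d) c : MvPolynomial (Fin 3) ℂ) =
      c • monomial (s + d) (1 : ℂ) := by simp [smul_monomial]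
  rw [h, map_smul, shiftMap, Module.Basis.constr_basis, if_pos le_self_add,
    add_tsub_cancel_left, h']
  rfl

lemma shiftMap_monomial_of_not_le {a m : Fin 3 →₀ ℕ} (s : Fin 3 →₀ ℕ) (h : ¬ a ≤ m) (c : ℂ) :
    shiftMap I a s (monomial m c) = 0 := by
  have h' : (monomial m c : MvPolynomial (Fin 3) ℂ) =
      c • basisMonomials (Fin 3) ℂ m := by simp [smul_monomial]
  rw [h', map_smul, shiftMap, Module.Basis.constr_basis, if_neg h, smul_zero]

lemma shiftMap_smul (hI : IsMonomialIdeal I) {a s : Fin 3 →₀ ℕ}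
    (h : ∀ m, monomial m (1 : ℂ) ∈ I → ¬ a ≤ m → ∀ d e, m + d = a + e →
      monomial (s + e) (1 : ℂ) ∈ I)
    (q : MvPolynomial (Fin 3) ℂ) {p : MvPolynomial (Fin 3) ℂ} (hp : p ∈ I) :
    shiftMap I a s (q * p) = q • shiftMap I a s p := by
  refine hI.induction_on (P := fun p => shiftMap I a s (q * p) = q • shiftMap I a s p)
    (by simp) (fun p p' hp hp' => by rw [mul_add, map_add, map_add, hp, hp', smul_add])
    (fun m hm c => ?_) hp
  rw [q.as_sum, Finset.sum_mul, map_sum, Finset.sum_smul]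
  refine Finset.sum_congr rfl fun k _ => ?_
  rw [monomial_mul]
  by_cases ha : a ≤ m
  · obtain ⟨e, rfl⟩ := exists_add_of_le ha
    rw [add_left_comm, shiftMap_monomial_add, shiftMap_monomial_add, add_left_comm,
      ← monomial_mul, map_mul]
    rfl
  · rw [shiftMap_monomial_of_not_le s ha, smul_zero]
    by_cases hk : a ≤ k + m
    · obtain ⟨e, he⟩ := exists_add_of_le hk
      rw [he, shiftMap_monomial_add, Ideal.Quotient.eq_zero_iff_mem]
      exact monomial_mem_of_le (h m hm ha k e (by rw [← he, add_comm])) le_rfl _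
    · exact shiftMap_monomial_of_not_le s hk _

/-- The `R`-linear map `I → R/I` sending `x^a` to `x^s` and killing the monomials that
are not divisible by `x^a`. -/
noncomputable def shiftHom (hI : IsMonomialIdeal I) {a s : Fin 3 →₀ ℕ}
    (h : ∀ m, monomial m (1 : ℂ) ∈ I → ¬ a ≤ m → ∀ d e, m + d = a + e →
      monomial (s + e) (1 : ℂ) ∈ I) :
    ↥I →ₗ[MvPolynomial (Fin 3) ℂ] (MvPolynomial (Fin 3) ℂ ⧸ I) where
  toFun p := shiftMap I a s p.1
  map_add' _ _ := map_add _ _ _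
  map_smul' q p := shiftMap_smul hI h q p.2

lemma card_le_tangentDim (hI : IsMonomialIdeal I) [Module.Finite ℂ
      (↥I →ₗ[MvPolynomial (Fin 3) ℂ] (MvPolynomial (Fin 3) ℂ ⧸ I))]
    {Q : Finset ((Fin 3 →₀ ℕ) × (Fin 3 →₀ ℕ))}
    (hQ : ∀ x ∈ Q, monomial x.1 (1 : ℂ) ∈ I ∧ monomial x.2 (1 : ℂ) ∉ I ∧
      ∀ m, monomial m (1 : ℂ) ∈ I → ¬ x.1 ≤ m → ∀ d e, m + d = x.1 + e →
        monomial (x.2 + e) (1 : ℂ) ∈ I) :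
    Q.card ≤ tangentDim I := by
  classical
  let v : Q → (↥I →ₗ[MvPolynomial (Fin 3) ℂ] (MvPolynomial (Fin 3) ℂ ⧸ I)) :=
    fun x => shiftHom hI (hQ x.1 x.2).2.2
  have hmin : ∀ x ∈ Q, ∀ m, monomial m (1 : ℂ) ∈ I → m ≤ x.1 → m = x.1 := by
    intro x hx m hm hle
    by_contra hne
    obtain ⟨d, hd⟩ := exists_add_of_le hle
    have := (hQ x hx).2.2 m hm (fun h => hne (le_antisymm hle h)) d 0 (by rw [← hd, add_zero])
    exact (hQ x hx).2.1 (by simpa using this)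
  have hli : LinearIndependent ℂ v := by
    rw [linearIndependent_iff']
    intro t c hc x hx
    have h := congrArg (fun φ => quotCoeff I x.1.2 (φ ⟨_, (hQ x.1 x.2).1⟩)) hc
    have hterm : ∀ y : Q, quotCoeff I x.1.2 (v y ⟨_, (hQ x.1 x.2).1⟩) =
        if y = x then 1 else 0 := by
      intro y
      change quotCoeff I x.1.2 (shiftMap I y.1.1 y.1.2 (monomial x.1.1 1)) = _
      by_cases hxy : y.1.1 = x.1.1
      · have := shiftMap_monomial_add (I := I) y.1.1 y.1.2 0 1
        rw [add_zero, add_zero] at this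
        rw [← hxy, this, quotCoeff_mk hI (hQ x.1 x.2).2.1, coeff_monomial]
        simp only [Subtype.ext_iff, Prod.ext_iff, hxy, true_and]
      · rw [shiftMap_monomial_of_not_le _ (fun h => hxy
          (hmin x.1 x.2 _ (hQ y.1 y.2).1 h)), map_zero, if_neg]
        rintro rfl
        exact hxy rfl
    simp only [LinearMap.sum_apply, LinearMap.smul_apply, map_sum, map_smul, hterm,
      LinearMap.zero_apply, map_zero] at h
    simpa [hx] using h
  have := hli.fintype_card_le_finrank
  simpa [tangentDim] using this

end MonomialIdeals

section Columns

/-- The exponent of `x^a y^b z^c`. -/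
noncomputable def expo (a b c : ℕ) : Fin 3 →₀ ℕ := Finsupp.equivFunOnFinite.symm ![a, b, c]

lemma expo_add (a b c a' b' c' : ℕ) :
    expo a b c + expo a' b' c' = expo (a + a') (b + b') (c + c') := by
  ext i; fin_cases i <;> simp [expo]

lemma expo_sub (a b c a' b' c' : ℕ) :
    expo a b c - expo a' b' c' = expo (a - a') (b - b') (c - c') := by
  ext i; fin_cases i <;> simp [expo]

lemma single_zero_eq_expo (n : ℕ) : Finsupp.single 0 n = expo n 0 0 := by
  ext i; fin_cases i <;> simp [expo]

lemma single_one_eq_expo (n : ℕ) : Finsupp.single 1 n = expo 0 n 0 := by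
  ext i; fin_cases i <;> simp [expo]

lemma single_two_eq_expo (n : ℕ) : Finsupp.single 2 n = expo 0 0 n := by
  ext i; fin_cases i <;> simp [expo]

lemma expo_le_iff {a b c a' b' c' : ℕ} :
    expo a b c ≤ expo a' b' c' ↔ a ≤ a' ∧ b ≤ b' ∧ c ≤ c' := by
  simp [Finsupp.le_def, Fin.forall_fin_succ, expo]

lemma expo_inj {a b c a' b' c' : ℕ} :
    expo a b c = expo a' b' c' ↔ a = a' ∧ b = b' ∧ c = c' := by
  simp only [le_antisymm_iff, expo_le_iff]; tauto

lemma expo_apply_self (d : Fin 3 →₀ ℕ) : expo (d 0) (d 1) (d 2) = d := by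
  ext i; fin_cases i <;> simp [expo]

/-- The monomials outside `I` are the `x^a y^b z^c` with `c < r a b`. -/
def HasColumns (I : Ideal (MvPolynomial (Fin 3) ℂ)) (r : ℕ → ℕ → ℕ) : Prop :=
  ∀ a b c, monomial (expo a b c) (1 : ℂ) ∈ I ↔ r a b ≤ c

/-- The column heights vanish outside the base `{0, …, A - 1} × {0, …, B - 1}`. -/
def SupportedOn (r : ℕ → ℕ → ℕ) (A B : ℕ) : Prop :=
  ∀ a b, A ≤ a ∨ B ≤ b → r a b = 0

variable {I : Ideal (MvPolynomial (Fin 3) ℂ)} {r : ℕ → ℕ → ℕ} {A B : ℕ}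

lemma HasColumns.card_eq_sum (h : HasColumns I r) (hr : SupportedOn r A B) :
    Nat.card {s : Fin 3 →₀ ℕ // monomial s (1 : ℂ) ∉ I} =
      ∑ a ∈ Finset.range A, ∑ b ∈ Finset.range B, r a b := by
  let e : {s : Fin 3 →₀ ℕ // monomial s (1 : ℂ) ∉ I} ≃
      ((Finset.range A).sigma fun a => (Finset.range B).sigma fun b => Finset.range (r a b)) :=
    { toFun s := ⟨⟨s.1 0, s.1 1, s.1 2⟩, by
        obtain ⟨s, hs⟩ := s
        rw [← expo_apply_self s, h, not_le] at hs
        have h1 : ¬ (A ≤ s 0 ∨ B ≤ s 1) := fun h' => by rw [hr _ _ h'] at hs; omega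
        simp only [Finset.mem_sigma, Finset.mem_range]
        omega⟩
      invFun t := ⟨expo t.1.1 t.1.2.1 t.1.2.2, by
        obtain ⟨t, ht⟩ := t
        simp only [Finset.mem_sigma, Finset.mem_range] at ht
        rw [h, not_le]
        exact ht.2.2⟩
      left_inv s := Subtype.ext (expo_apply_self s.1)
      right_inv t := by simp [expo] }
  rw [Nat.card_congr e, Nat.card_eq_fintype_card, Fintype.card_coe, Finset.card_sigma]
  simp [Finset.card_sigma]

/-- Generators of an ideal with column heights supported on `{0, 1, 2} × {0, 1, 2, 3}`. -/
noncomputable def colGen (r : ℕ → ℕ → ℕ) (n : ℕ) : Fin 3 →₀ ℕ :=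
  expo (n / 5) (n % 5) (r (n / 5) (n % 5))

/-- Comparison of the generators with indices `n` and `j` shows that the coefficient at
`x^a y^b z^c` of the image of the `n`-th generator is zero or a coefficient of the image of an
earlier generator. -/
def isReducible (r : ℕ → ℕ → ℕ) (n a b c j : ℕ) : Bool :=
  Nat.blt (c + (r (j / 5) (j % 5) - r (n / 5) (n % 5)))
      (r (a + (j / 5 - n / 5)) (b + (j % 5 - n % 5))) &&
    (Nat.blt j n || Nat.blt a (n / 5 - j / 5) || Nat.blt b (n % 5 - j % 5) ||
      Nat.blt c (r (n / 5) (n % 5) - r (j / 5) (j % 5)))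

/-- The map sending the `n`-th generator to `x^a y^b z^c` and the `j`-th one to zero is
compatible with the relations between the two, or the `j`-th one is a multiple of the
`n`-th. -/
def isCompatible (r : ℕ → ℕ → ℕ) (n a b c j : ℕ) : Bool :=
  (Nat.ble (n / 5) (j / 5) && Nat.ble (n % 5) (j % 5) &&
      Nat.ble (r (n / 5) (n % 5)) (r (j / 5) (j % 5))) ||
    Nat.ble (r (a + (j / 5 - n / 5)) (b + (j % 5 - n % 5)))
      (c + (r (j / 5) (j % 5) - r (n / 5) (n % 5)))

/-- The `n`-th generator is a multiple of the `j`-th. -/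
def isMultiple (r : ℕ → ℕ → ℕ) (n j : ℕ) : Bool :=
  Nat.ble (j / 5) (n / 5) && Nat.ble (j % 5) (n % 5) &&
    Nat.ble (r (j / 5) (j % 5)) (r (n / 5) (n % 5))

/-- The pairs of a generator index and a monomial outside the ideal, omitting the multiples of
earlier generators. -/
def colPairs (r : ℕ → ℕ → ℕ) : List (ℕ × ℕ × ℕ × ℕ) :=
  ((List.range 20).filter fun n => !(List.range n).any (isMultiple r n)).flatMap fun n => (List.range 3).flatMap fun a =>
    (List.range 4).flatMap fun b => (List.range (r a b)).map fun c => (n, a, b, c)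

/-- The pairs that cannot be reduced in one step. -/
def irreduciblePairs (r : ℕ → ℕ → ℕ) : List (ℕ × ℕ × ℕ × ℕ) :=
  (colPairs r).filter fun x =>
    !(List.range 20).any (isReducible r x.1 x.2.1 x.2.2.1 x.2.2.2)

/-- The pairs that define a homomorphism supported on a single generator. -/
def freePairs (r : ℕ → ℕ → ℕ) : List (ℕ × ℕ × ℕ × ℕ) :=
  (colPairs r).filter fun x =>
    (List.range 20).all (isCompatible r x.1 x.2.1 x.2.2.1 x.2.2.2)

open Classical in
/-- The irreducible pairs, with exponents in place of triples. -/
noncomputable def irreducibleCoeffs (r : ℕ → ℕ → ℕ) : Finset (ℕ × (Fin 3 →₀ ℕ)) :=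
  ((irreduciblePairs r).map fun x => (x.1, expo x.2.1 x.2.2.1 x.2.2.2)).toFinset

lemma mem_colPairs {n a b c : ℕ} :
    (n, a, b, c) ∈ colPairs r ↔
      (n < 20 ∧ ∀ j < n, isMultiple r n j = false) ∧ a < 3 ∧ b < 4 ∧ c < r a b := by
  simp [colPairs]

lemma HasColumns.colGen_mem (h : HasColumns I r) (n : ℕ) :
    monomial (colGen r n) (1 : ℂ) ∈ I :=
  (h _ _ _).2 le_rfl

lemma HasColumns.exists_colGen_le (h : HasColumns I r) (hr : SupportedOn r 3 4)
    (m : Fin 3 →₀ ℕ) (hm : monomial m (1 : ℂ) ∈ I) : ∃ n < 20, colGen r n ≤ m := by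
  rw [← expo_apply_self m, h] at hm
  refine ⟨5 * min (m 0) 3 + min (m 1) 4, by omega, ?_⟩
  have h1 : (5 * min (m 0) 3 + min (m 1) 4) / 5 = min (m 0) 3 := by omega
  have h2 : (5 * min (m 0) 3 + min (m 1) 4) % 5 = min (m 1) 4 := by omega
  rw [colGen, h1, h2]
  conv_rhs => rw [← expo_apply_self m]
  rw [expo_le_iff]
  refine ⟨min_le_left _ _, min_le_left _ _, ?_⟩
  by_cases h' : 3 ≤ m 0 ∨ 4 ≤ m 1
  · rw [hr (min (m 0) 3) (min (m 1) 4) (by omega)]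
    exact Nat.zero_le _
  · rwa [min_eq_left (by omega), min_eq_left (by omega)]

lemma HasColumns.irreducibleCoeffs_spec (h : HasColumns I r) (hr : SupportedOn r 3 4)
    (n : ℕ) (hn : n < 20) (s : Fin 3 →₀ ℕ) (hs : monomial s (1 : ℂ) ∉ I) :
    (n, s) ∈ irreducibleCoeffs r ∨
      ∃ j d e, colGen r n + d = colGen r j + e ∧ j < 20 ∧ monomial (s + d) (1 : ℂ) ∉ I ∧
        (j < n ∨ ¬ e ≤ s + d) := by
  rw [or_iff_not_imp_left]
  intro hns
  replace hns : (n, s 0, s 1, s 2) ∉ irreduciblePairs r := fun hx => hns <| by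
    rw [irreducibleCoeffs, List.mem_toFinset, List.mem_map]
    exact ⟨_, hx, by simp only [expo_apply_self]⟩
  have hs' := hs
  rw [← expo_apply_self s, h, not_le] at hs'
  have h1 : ¬ (3 ≤ s 0 ∨ 4 ≤ s 1) := fun h' => by rw [hr _ _ h'] at hs'; omega
  by_cases hmin : ∃ j < n, isMultiple r n j = true
  · obtain ⟨j, hjn, hmul⟩ := hmin
    simp only [isMultiple, Bool.and_eq_true, Nat.ble_eq] at hmul
    have hle : colGen r j ≤ colGen r n := by
      rw [colGen, colGen, expo_le_iff]
      tauto
    obtain ⟨e, he⟩ := exists_add_of_le hle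
    exact ⟨j, 0, e, by rw [add_zero, he], hjn.trans hn, by rwa [add_zero], Or.inl hjn⟩
  have hmem : (n, s 0, s 1, s 2) ∈ colPairs r :=
    mem_colPairs.2 ⟨⟨hn, by simpa using hmin⟩, by omega⟩
  simp only [irreduciblePairs, List.mem_filter, hmem, true_and, Bool.not_eq_true',
    Bool.not_eq_false, List.any_eq_true, List.mem_range] at hns
  obtain ⟨j, hj, hred⟩ := hns
  simp only [isReducible, Bool.and_eq_true, Bool.or_eq_true, Nat.blt_eq] at hred
  refine ⟨j, expo (j / 5 - n / 5) (j % 5 - n % 5) (r (j / 5) (j % 5) - r (n / 5) (n % 5)),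
    expo (n / 5 - j / 5) (n % 5 - j % 5) (r (n / 5) (n % 5) - r (j / 5) (j % 5)), ?_, hj, ?_, ?_⟩
  · rw [colGen, colGen, expo_add, expo_add, expo_inj]
    omega
  · rw [← expo_apply_self s, expo_add, h, not_le]
    exact hred.1
  · rw [← expo_apply_self s, expo_add, expo_le_iff]
    omega

lemma HasColumns.tangentDim_le (h : HasColumns I r) (hI : IsMonomialIdeal I)
    (hr : SupportedOn r 3 4) : tangentDim I ≤ (irreduciblePairs r).length :=
  (tangentDim_le_card hI h.colGen_mem (h.exists_colGen_le hr)
    (h.irreducibleCoeffs_spec hr)).trans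
    ((List.toFinset_card_le _).trans (List.length_map _).le)

lemma HasColumns.finite_hom (h : HasColumns I r) (hI : IsMonomialIdeal I)
    (hr : SupportedOn r 3 4) : Module.Finite ℂ
      (↥I →ₗ[MvPolynomial (Fin 3) ℂ] (MvPolynomial (Fin 3) ℂ ⧸ I)) :=
  Module.Finite.of_injective _ (homCoeffs_injective hI h.colGen_mem
    (h.exists_colGen_le hr) (h.irreducibleCoeffs_spec hr))

lemma HasColumns.le_tangentDim (h : HasColumns I r) (hI : IsMonomialIdeal I)
    (hr : SupportedOn r 3 4) : (freePairs r).toFinset.card ≤ tangentDim I := by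
  classical
  have := h.finite_hom hI hr
  let f : ℕ × ℕ × ℕ × ℕ → (Fin 3 →₀ ℕ) × (Fin 3 →₀ ℕ) :=
    fun x => (colGen r x.1, expo x.2.1 x.2.2.1 x.2.2.2)
  have hf : Function.Injective f := by
    rintro ⟨n, a, b, c⟩ ⟨n', a', b', c'⟩ hx
    simp only [f, colGen, Prod.mk.injEq, expo_inj] at hx ⊢
    omega
  rw [← Finset.card_image_of_injective _ hf]
  refine card_le_tangentDim hI fun x hx => ?_
  rw [Finset.mem_image] at hx
  obtain ⟨⟨n, a, b, c⟩, hx, rfl⟩ := hx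
  rw [List.mem_toFinset, freePairs, List.mem_filter, mem_colPairs, List.all_eq_true] at hx
  obtain ⟨⟨-, -, -, hc⟩, hx⟩ := hx
  refine ⟨h.colGen_mem n, by rwa [h, not_le], fun m hm hnm d e hde => ?_⟩
  obtain ⟨j, hj, hjm⟩ := h.exists_colGen_le hr m hm
  have hcomp := hx j (List.mem_range.2 hj)
  simp only [isCompatible, Bool.or_eq_true, Bool.and_eq_true, Nat.ble_eq] at hcomp
  have hjn : ¬ colGen r n ≤ colGen r j := fun h' => hnm (h'.trans hjm)
  have hje : colGen r j ≤ colGen r n + e := hjm.trans (hde ▸ le_self_add)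
  rw [← expo_apply_self e, colGen, colGen, expo_add, expo_le_iff] at hje
  rw [colGen, colGen, expo_le_iff] at hjn
  refine monomial_mem_of_le ((h _ _ _).2 (hcomp.resolve_left fun h' => hjn (by tauto))) ?_ 1
  rw [← expo_apply_self e, expo_add, expo_le_iff]
  dsimp only
  omega

end Columns

/-- Column heights read off from a list of rows. -/
def rowHeights (L : List (List ℕ)) (a b : ℕ) : ℕ := (L.getD a []).getD b 0

/-- The rows of column heights with total `12`, given all of them but the first. -/
def rowsTwelve (l₁ l₂ l₃ m₀ m₁ m₂ n₀ n₁ : ℕ) : List (List ℕ) :=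
  [[12 - (l₁ + l₂ + l₃ + m₀ + m₁ + m₂ + n₀ + n₁), l₁, l₂, l₃], [m₀, m₁, m₂], [n₀, n₁]]

/-- An upper bound for the dimension of the tangent space, depending on the vanishing of
the first entries of the second and the third row. -/
def tangentBound (m₀ n₀ : ℕ) : ℕ := if n₀ = 0 then if m₀ = 0 then 53 else 54 else 66

lemma all_length_irreduciblePairs_le :
    ((List.range 6).all fun l₁ => (List.range 4).all fun l₂ => (List.range 2).all fun l₃ =>
      Nat.blt (l₁ - 1) l₂ || Nat.blt (l₂ - 1) l₃ ||
      (List.range (l₁ + 1)).all fun m₀ => (List.range (l₂ + 1)).all fun m₁ =>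
      (List.range (l₃ + 1)).all fun m₂ => Nat.blt (m₀ - 1) m₁ || Nat.blt (m₁ - 1) m₂ ||
      (List.range (m₁ + 1)).all fun n₀ => (List.range (m₂ + 1)).all fun n₁ =>
      Nat.blt (n₀ - 1) n₁ || Nat.ble 12 (l₁ + (l₁ + l₂ + l₃ + m₀ + m₁ + m₂ + n₀ + n₁)) ||
      Nat.ble (irreduciblePairs (rowHeights (rowsTwelve l₁ l₂ l₃ m₀ m₁ m₂ n₀ n₁))).length
        (tangentBound m₀ n₀)) = true := by
  decide +kernel

lemma length_irreduciblePairs_le {l₁ l₂ l₃ m₀ m₁ m₂ n₀ n₁ : ℕ} (hl₂ : l₂ ≤ l₁ - 1)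
    (hl₃ : l₃ ≤ l₂ - 1) (hm₀ : m₀ ≤ l₁) (hm₁ : m₁ ≤ l₂) (hm₂ : m₂ ≤ l₃) (hm₁' : m₁ ≤ m₀ - 1)
    (hm₂' : m₂ ≤ m₁ - 1) (hn₀ : n₀ ≤ m₁) (hn₁ : n₁ ≤ m₂) (hn₁' : n₁ ≤ n₀ - 1)
    (h : l₁ + (l₁ + l₂ + l₃ + m₀ + m₁ + m₂ + n₀ + n₁) < 12) :
    (irreduciblePairs (rowHeights (rowsTwelve l₁ l₂ l₃ m₀ m₁ m₂ n₀ n₁))).length ≤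
      tangentBound m₀ n₀ := by
  have key := all_length_irreduciblePairs_le
  simp only [List.all_eq_true, List.mem_range, Bool.or_eq_true, Nat.blt_eq, Nat.ble_eq] at key
  have h₁ := (key l₁ (by omega) l₂ (by omega) l₃ (by omega)).resolve_left (by omega)
  have h₂ := (h₁ m₀ (by omega) m₁ (by omega) m₂ (by omega)).resolve_left (by omega)
  exact (h₂ n₀ (by omega) n₁ (by omega)).resolve_left (by omega)

lemma card_freePairs_two : (freePairs (rowHeights [[6, 3], [3]])).toFinset.card = 54 := by
  decide +kernel

lemma card_freePairs_three :
    (freePairs (rowHeights [[5, 2, 1], [2, 1], [1]])).toFinset.card = 66 := by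
  decide +kernel

section StronglyStable

variable {I : Ideal (MvPolynomial (Fin 3) ℂ)} {r : ℕ → ℕ → ℕ}

/-- The conditions on the column heights that characterize Borel-fixed ideals. -/
structure IsBorelHeights (r : ℕ → ℕ → ℕ) : Prop where
  le_pred : ∀ a b, r a (b + 1) ≤ r a b - 1
  succ_le : ∀ a b, r (a + 1) b ≤ r a (b + 1)

lemma IsBorelHeights.antitone (h : IsBorelHeights r) {a b a' b' : ℕ} (ha : a ≤ a')
    (hb : b ≤ b') : r a' b' ≤ r a b := by
  have h1 : Antitone (r a') := antitone_nat_of_succ_le fun b => (h.le_pred a' b).trans (by omega)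
  have h2 : Antitone fun a => r a b := antitone_nat_of_succ_le fun a =>
    (h.succ_le a b).trans ((h.le_pred a b).trans (by omega))
  exact (h1 hb).trans (h2 ha)

/-- The monomial ideal with given column heights. -/
noncomputable def columnIdeal (h : IsBorelHeights r) : Ideal (MvPolynomial (Fin 3) ℂ) :=
  restrictSupportIdeal (R := ℂ) {d : Fin 3 →₀ ℕ | r (d 0) (d 1) ≤ d 2} fun _ _ hde hd =>
    (h.antitone (hde 0) (hde 1)).trans (le_trans hd (hde 2))

lemma mem_columnIdeal (h : IsBorelHeights r) {p : MvPolynomial (Fin 3) ℂ} :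
    p ∈ columnIdeal h ↔ ∀ d ∈ p.support, r (d 0) (d 1) ≤ d 2 := Iff.rfl

lemma monomial_mem_columnIdeal (h : IsBorelHeights r) (d : Fin 3 →₀ ℕ) :
    monomial d (1 : ℂ) ∈ columnIdeal h ↔ r (d 0) (d 1) ≤ d 2 := by
  classical
  simp [mem_columnIdeal, support_monomial]

lemma hasColumns_columnIdeal (h : IsBorelHeights r) : HasColumns (columnIdeal h) r :=
  fun a b c => by simp [monomial_mem_columnIdeal, expo]

lemma isMonomialIdeal_columnIdeal (h : IsBorelHeights r) : IsMonomialIdeal (columnIdeal h) :=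
  fun _ hp d hd => (monomial_mem_columnIdeal h d).2 (hp hd)

lemma isBorelFixed_columnIdeal (h : IsBorelHeights r) : IsBorelFixed (columnIdeal h) := by
  intro d hd i j hij hj
  rw [monomial_mem_columnIdeal] at hd ⊢
  have h1 := h.le_pred (d 0) (d 1)
  have h2 := h.succ_le (d 0) (d 1)
  fin_cases i <;> fin_cases j <;> simp at hij hj ⊢
  · have h3 := h.succ_le (d 0) (d 1 - 1)
    rw [Nat.sub_add_cancel hj] at h3
    omega
  · omega
  · omega

lemma X_pow_mem_iff (h : HasColumns I r) (m : ℕ) :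
    (X 0 : MvPolynomial (Fin 3) ℂ) ^ m ∈ I ↔ r m 0 = 0 := by
  rw [X_pow_eq_monomial, single_zero_eq_expo, h, Nat.le_zero]

lemma exists_hasColumns (hI : IsMonomialIdeal I) (hB : IsBorelFixed I)
    (hfin : 0 < Module.finrank ℂ (MvPolynomial (Fin 3) ℂ ⧸ I)) :
    ∃ r, HasColumns I r ∧ IsBorelHeights r := by
  classical
  rw [finrank_quotient_eq_card hI] at hfin
  have : Finite {s : Fin 3 →₀ ℕ // monomial s (1 : ℂ) ∉ I} := (Nat.card_pos_iff.1 hfin).2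
  have hex : ∀ a b, ∃ c, monomial (expo a b c) (1 : ℂ) ∈ I := by
    intro a b
    by_contra! hne
    refine not_injective_infinite_finite
      (fun c => (⟨expo a b c, hne c⟩ : {s : Fin 3 →₀ ℕ // monomial s (1 : ℂ) ∉ I})) ?_
    intro c c' hcc
    exact (expo_inj.1 (congrArg Subtype.val hcc)).2.2
  obtain ⟨r, hcol⟩ : ∃ r, HasColumns I r := by
    refine ⟨fun a b => Nat.find (hex a b), fun a b c => ?_⟩
    rw [Nat.find_le_iff]
    exact ⟨fun h => ⟨c, le_rfl, h⟩, fun ⟨c', hc, h⟩ =>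
      monomial_mem_of_le h (expo_le_iff.2 ⟨le_rfl, le_rfl, hc⟩) 1⟩
  refine ⟨r, hcol, ⟨fun a b => ?_, fun a b => ?_⟩⟩
  · rw [← hcol]
    have hmem := (hcol a b _).2 le_rfl
    rcases Nat.eq_zero_or_pos (r a b) with h0 | hpos
    · rw [h0] at hmem ⊢
      exact monomial_mem_of_le hmem (expo_le_iff.2 ⟨le_rfl, by omega, le_rfl⟩) 1
    · have := hB _ hmem 1 2 (by decide) (by simpa [expo] using hpos)
      have heq : expo a b (r a b) + Finsupp.single 1 1 - Finsupp.single 2 1 =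
          expo a (b + 1) (r a b - 1) := by
        rw [single_one_eq_expo, single_two_eq_expo, expo_add, expo_sub]; simp
      rwa [heq] at this
  · rw [← hcol]
    have hmem := (hcol a (b + 1) _).2 le_rfl
    have := hB _ hmem 0 1 (by decide) (by simp [expo])
    have heq : expo a (b + 1) (r a (b + 1)) + Finsupp.single 0 1 - Finsupp.single 1 1 =
        expo (a + 1) b (r a (b + 1)) := by
      rw [single_zero_eq_expo, single_one_eq_expo, expo_add, expo_sub]; simp
    rwa [heq] at this

lemma IsBorelHeights.supportedOn (h : IsBorelHeights r) {A B : ℕ} (hA : r A 0 = 0)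
    (hB : r 0 B = 0) : SupportedOn r A B := by
  rintro a b (ha | hb)
  · exact Nat.le_zero.1 ((h.antitone ha b.zero_le).trans hA.le)
  · exact Nat.le_zero.1 ((h.antitone a.zero_le hb).trans hB.le)

lemma IsBorelHeights.add_le (h : IsBorelHeights r) {b : ℕ} (hb : 0 < r 0 b) :
    r 0 b + b ≤ r 0 0 := by
  induction b with
  | zero => simp
  | succ b ih =>
    have := h.le_pred 0 b
    have := ih (by omega)
    omega

lemma tangentDim_le_tangentBound (hI : IsMonomialIdeal I) (hcol : HasColumns I r)
    (h : IsBorelHeights r) (hcard : Module.finrank ℂ (MvPolynomial (Fin 3) ℂ ⧸ I) = 12)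
    (hx : r 3 0 = 0) : tangentDim I ≤ tangentBound (r 1 0) (r 2 0) := by
  rw [finrank_quotient_eq_card hI] at hcard
  have h4 : r 0 4 = 0 := by
    by_contra hne
    have hB : r 0 (r 0 0 + 5) = 0 := by
      by_contra hne'
      have := h.add_le (Nat.pos_of_ne_zero hne')
      omega
    rw [hcol.card_eq_sum (h.supportedOn hx hB)] at hcard
    have h5 : ∑ b ∈ Finset.range 5, r 0 b ≤ 12 := by
      rw [← hcard]
      refine le_trans ?_ (Finset.single_le_sum
        (f := fun a => ∑ b ∈ Finset.range (r 0 0 + 5), r a b) (fun _ _ => Nat.zero_le _)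
        (Finset.mem_range.2 (Nat.zero_lt_succ 2)))
      exact Finset.sum_le_sum_of_subset (Finset.range_subset_range.2 (by omega))
    simp only [Finset.sum_range_succ, Finset.sum_range_zero] at h5
    have h3 := h.le_pred 0 3
    have h2 := h.le_pred 0 2
    have h1 := h.le_pred 0 1
    have h0 := h.le_pred 0 0
    norm_num at h0 h1 h2 h3
    omega
  have hsupp := h.supportedOn hx h4
  rw [hcol.card_eq_sum hsupp] at hcard
  simp only [Finset.sum_range_succ, Finset.sum_range_zero, zero_add] at hcard
  have h00 := h.le_pred 0 0
  have h01 := h.le_pred 0 1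
  have h02 := h.le_pred 0 2
  have h10 := h.le_pred 1 0
  have h11 := h.le_pred 1 1
  have h20 := h.le_pred 2 0
  have s00 := h.succ_le 0 0
  have s01 := h.succ_le 0 1
  have s02 := h.succ_le 0 2
  have s03 := h.succ_le 0 3
  have s10 := h.succ_le 1 0
  have s11 := h.succ_le 1 1
  have s12 := h.succ_le 1 2
  have s13 := h.succ_le 1 3
  have z14 := hsupp 1 4 (by omega)
  simp only [zero_add, Nat.reduceAdd] at h00 h01 h02 h10 h11 h20 s00 s01 s02 s03 s10 s11 s12 s13
  have hr : r = rowHeights (rowsTwelve (r 0 1) (r 0 2) (r 0 3) (r 1 0) (r 1 1) (r 1 2)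
      (r 2 0) (r 2 1)) := by
    funext a b
    by_cases hab : 3 ≤ a ∨ 4 ≤ b
    · rw [hsupp a b hab]
      rcases a with _ | _ | _ | a <;> rcases b with _ | _ | _ | _ | b <;>
        first | omega | simp [rowHeights, rowsTwelve]
    · have ha : a < 3 := by omega
      have hb : b < 4 := by omega
      interval_cases a <;> interval_cases b <;> simp [rowHeights, rowsTwelve] <;> omega
  refine (hcol.tangentDim_le hI hsupp).trans ?_
  rw [hr]
  exact length_irreduciblePairs_le (by omega) (by omega) (by omega) (by omega) (by omega)
    (by omega) (by omega) (by omega) (by omega) (by omega) (by omega)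

lemma exists_mem_of_isBorelHeights (h : IsBorelHeights r) {m T : ℕ} (hm : r m 0 = 0)
    (hm' : r (m - 1) 0 ≠ 0) (hsupp : SupportedOn r 3 4)
    (hcard : ∑ a ∈ Finset.range 3, ∑ b ∈ Finset.range 4, r a b = 12)
    (hT : (freePairs r).toFinset.card = T) (hle : tangentBound (r 1 0) (r 2 0) = T) :
    ∃ I : Ideal (MvPolynomial (Fin 3) ℂ),
      IsMonomialIdeal I ∧ IsBorelFixed I ∧
      Module.finrank ℂ (MvPolynomial (Fin 3) ℂ ⧸ I) = 12 ∧
      (X 0 : MvPolynomial (Fin 3) ℂ) ^ m ∈ I ∧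
      (X 0 : MvPolynomial (Fin 3) ℂ) ^ (m - 1) ∉ I ∧
      T = tangentDim I := by
  have hI := isMonomialIdeal_columnIdeal h
  have hcol := hasColumns_columnIdeal h
  have hfin : Module.finrank ℂ (MvPolynomial (Fin 3) ℂ ⧸ columnIdeal h) = 12 := by
    rw [finrank_quotient_eq_card hI, hcol.card_eq_sum hsupp, hcard]
  refine ⟨columnIdeal h, hI, isBorelFixed_columnIdeal h, hfin, (X_pow_mem_iff hcol m).2 hm,
    fun hmem => hm' ((X_pow_mem_iff hcol _).1 hmem), le_antisymm ?_ ?_⟩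
  · exact hT ▸ hcol.le_tangentDim hI hsupp
  · exact hle ▸ tangentDim_le_tangentBound hI hcol h hfin (hsupp 3 0 (by omega))

lemma tangentDim_le_of_X_pow_mem (hI : IsMonomialIdeal I) (hB : IsBorelFixed I)
    (hcard : Module.finrank ℂ (MvPolynomial (Fin 3) ℂ ⧸ I) = 12) {m : ℕ} (hm : m ≤ 3)
    (hx : (X 0 : MvPolynomial (Fin 3) ℂ) ^ m ∈ I) :
    tangentDim I ≤ tangentBound (if m ≤ 1 then 0 else 1) (if m ≤ 2 then 0 else 1) := by
  obtain ⟨r, hcol, h⟩ := exists_hasColumns hI hB (by omega)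
  rw [X_pow_mem_iff hcol] at hx
  have hzero : ∀ a, m ≤ a → r a 0 = 0 := fun a ha =>
    Nat.le_zero.1 ((h.antitone ha le_rfl).trans hx.le)
  have := hzero 1
  have := hzero 2
  refine (tangentDim_le_tangentBound hI hcol h hcard (hzero 3 hm)).trans ?_
  unfold tangentBound
  split_ifs <;> first | omega | grind

lemma isBorelHeights_two : IsBorelHeights (rowHeights [[6, 3], [3]]) := by
  constructor <;> rintro (_ | _ | a) (_ | _ | b) <;> simp [rowHeights]

lemma isBorelHeights_three : IsBorelHeights (rowHeights [[5, 2, 1], [2, 1], [1]]) := by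
  constructor <;> rintro (_ | _ | _ | a) (_ | _ | _ | b) <;> simp [rowHeights]

end StronglyStable

theorem Tmax_monotonicity_l12 :
    TmaxEq 12 2 54 ∧
    TmaxEq 12 3 66 ∧
    (∀ T1 T2 T3 : ℕ, TmaxEq 12 1 T1 → TmaxEq 12 2 T2 → TmaxEq 12 3 T3 →
      T1 < T2 ∧ T2 < T3) := by
  have h2 : TmaxEq 12 2 54 := by
    refine ⟨exists_mem_of_isBorelHeights isBorelHeights_two rfl (by decide)
      (isBorelHeights_two.supportedOn rfl rfl) rfl card_freePairs_two rfl, ?_⟩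
    rintro t ⟨I, hI, hB, hcard, hx, -, rfl⟩
    exact tangentDim_le_of_X_pow_mem hI hB hcard (by norm_num) hx
  have h3 : TmaxEq 12 3 66 := by
    refine ⟨exists_mem_of_isBorelHeights isBorelHeights_three rfl (by decide)
      (isBorelHeights_three.supportedOn rfl rfl) rfl card_freePairs_three rfl, ?_⟩
    rintro t ⟨I, hI, hB, hcard, hx, -, rfl⟩
    exact tangentDim_le_of_X_pow_mem hI hB hcard (by norm_num) hx
  refine ⟨h2, h3, fun T1 T2 T3 hT1 hT2 hT3 => ?_⟩
  obtain ⟨I, hI, hB, hcard, hx, -, rfl⟩ := hT1.1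
  have hle : tangentDim I ≤ 53 := tangentDim_le_of_X_pow_mem hI hB hcard (by norm_num) hx
  rw [hT2.unique h2, hT3.unique h3]
  omega
end

section
/- T_{max,2}(13) = 61 and T_{max,3}(13) = 69; in particular, for l = 13 the function m1 ↦ T_{max,m1}(13) is strictly increasing on {1, 2, 3}. -/
open MvPolynomial

namespace BorelTangent

section Quotient

variable {I : Ideal (MvPolynomial (Fin 3) ℂ)}

theorem coeff_eq_zero_of_mem (hI : IsMonomialIdeal I) {p : MvPolynomial (Fin 3) ℂ} (hp : p ∈ I)
    {n : Fin 3 →₀ ℕ} (hn : monomial n (1 : ℂ) ∉ I) : coeff n p = 0 := by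
  by_contra h
  exact hn (hI p hp n (mem_support_iff.2 h))

theorem monomial_mem {m : Fin 3 →₀ ℕ} (hm : monomial m (1 : ℂ) ∈ I) (c : ℂ) :
    monomial m c ∈ I := by
  have := I.mul_mem_left (C c) hm
  rwa [C_mul_monomial, mul_one] at this

theorem mem_of_support {p : MvPolynomial (Fin 3) ℂ}
    (h : ∀ d ∈ p.support, monomial d (1 : ℂ) ∈ I) : p ∈ I := by
  rw [p.as_sum]
  exact I.sum_mem fun d hd => monomial_mem (h d hd) _

theorem monomial_mem_of_le {m m' : Fin 3 →₀ ℕ} (hm : monomial m (1 : ℂ) ∈ I) (h : m ≤ m') :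
    monomial m' (1 : ℂ) ∈ I := by
  have := I.mul_mem_left (monomial (m' - m) 1) hm
  rwa [monomial_mul, mul_one, tsub_add_cancel_of_le h] at this

/-- The exponents of the standard monomials of `I`. -/
def standard (I : Ideal (MvPolynomial (Fin 3) ℂ)) : Set (Fin 3 →₀ ℕ) :=
  {n | monomial n (1 : ℂ) ∉ I}

noncomputable def standardPart (I : Ideal (MvPolynomial (Fin 3) ℂ)) :
    MvPolynomial (Fin 3) ℂ →ₗ[ℂ] (standard I →₀ ℂ) :=
  Finsupp.lsubtypeDomain (standard I) ∘ₗ (basisMonomials (Fin 3) ℂ).repr.toLinearMap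

theorem standardPart_surjective : Function.Surjective (standardPart I) := by
  intro f
  refine ⟨(basisMonomials (Fin 3) ℂ).repr.symm (f.embDomain (Function.Embedding.subtype _)), ?_⟩
  ext n
  simp only [standardPart, LinearMap.comp_apply, LinearEquiv.coe_coe, LinearEquiv.apply_symm_apply,
    Finsupp.lsubtypeDomain_apply, Finsupp.subtypeDomain_apply]
  exact Finsupp.embDomain_apply_self (Function.Embedding.subtype _) f n

theorem ker_standardPart (hI : IsMonomialIdeal I) :
    LinearMap.ker (standardPart I) = I.restrictScalars ℂ := by
  ext p
  rw [LinearMap.mem_ker, Submodule.restrictScalars_mem]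
  constructor
  · intro h
    refine mem_of_support fun d hd => ?_
    by_contra hd'
    exact mem_support_iff.1 hd (DFunLike.congr_fun h ⟨d, hd'⟩)
  · intro h
    ext n
    exact coeff_eq_zero_of_mem hI h n.2

/-- Coordinates on `R / I` with respect to the standard monomials. -/
noncomputable def quotientRepr (hI : IsMonomialIdeal I) :
    (MvPolynomial (Fin 3) ℂ ⧸ I) ≃ₗ[ℂ] (standard I →₀ ℂ) :=
  (Submodule.Quotient.restrictScalarsEquiv ℂ I).symm ≪≫ₗ
    Submodule.quotEquivOfEq _ _ (ker_standardPart hI).symm ≪≫ₗ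
    (standardPart I).quotKerEquivOfSurjective standardPart_surjective

theorem quotientRepr_mk (hI : IsMonomialIdeal I) (p : MvPolynomial (Fin 3) ℂ) (n : standard I) :
    quotientRepr hI (Ideal.Quotient.mk I p) n = coeff n.1 p := rfl

theorem finrank_quotient (hI : IsMonomialIdeal I) :
    Module.finrank ℂ (MvPolynomial (Fin 3) ℂ ⧸ I) = Nat.card (standard I) :=
  Module.finrank_eq_nat_card_basis (Module.Basis.ofRepr (quotientRepr hI))

end Quotient

section Hom

variable {I : Ideal (MvPolynomial (Fin 3) ℂ)}

/-- The coefficient of `n` in the image of the monomial `m` under `φ`; zero unless `m ∈ I` and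
`n ∉ I`. -/
noncomputable def homCoeff (hI : IsMonomialIdeal I) (m n : Fin 3 →₀ ℕ) :
    (↥I →ₗ[MvPolynomial (Fin 3) ℂ] (MvPolynomial (Fin 3) ℂ ⧸ I)) →ₗ[ℂ] ℂ := by
  classical
  exact
  if h : monomial m (1 : ℂ) ∈ I ∧ n ∈ standard I then
    { toFun := fun φ => quotientRepr hI (φ ⟨_, h.1⟩) ⟨n, h.2⟩
      map_add' := fun φ ψ => by simp
      map_smul' := fun c φ => by simp }
  else 0

theorem homCoeff_apply (hI : IsMonomialIdeal I) {m n : Fin 3 →₀ ℕ}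
    (hm : monomial m (1 : ℂ) ∈ I) (hn : n ∈ standard I)
    (φ : ↥I →ₗ[MvPolynomial (Fin 3) ℂ] (MvPolynomial (Fin 3) ℂ ⧸ I)) :
    homCoeff hI m n φ = quotientRepr hI (φ ⟨_, hm⟩) ⟨n, hn⟩ := by
  simp [homCoeff, hm, hn]

theorem hom_monomial_add {m d : Fin 3 →₀ ℕ} (hm : monomial m (1 : ℂ) ∈ I)
    (hmd : monomial (m + d) (1 : ℂ) ∈ I)
    (φ : ↥I →ₗ[MvPolynomial (Fin 3) ℂ] (MvPolynomial (Fin 3) ℂ ⧸ I)) :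
    φ ⟨_, hmd⟩ = Ideal.Quotient.mk I (monomial d 1) * φ ⟨_, hm⟩ := by
  have : (⟨_, hmd⟩ : I) = (monomial d (1 : ℂ)) • (⟨_, hm⟩ : I) := by
    ext1
    simp [monomial_mul, add_comm]
  rw [this, map_smul]
  rfl

theorem homCoeff_add (hI : IsMonomialIdeal I) {m n d : Fin 3 →₀ ℕ}
    (hm : monomial m (1 : ℂ) ∈ I) (hn : n + d ∈ standard I)
    (φ : ↥I →ₗ[MvPolynomial (Fin 3) ℂ] (MvPolynomial (Fin 3) ℂ ⧸ I)) :
    homCoeff hI (m + d) (n + d) φ = homCoeff hI m n φ := by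
  have hmd := monomial_mem_of_le hm (le_add_of_nonneg_right (zero_le (a := d)))
  have hn' : n ∈ standard I := fun h =>
    hn (monomial_mem_of_le h (le_add_of_nonneg_right (zero_le (a := d))))
  rw [homCoeff_apply hI hmd hn, homCoeff_apply hI hm hn', hom_monomial_add hm]
  obtain ⟨p, hp⟩ := Ideal.Quotient.mk_surjective (φ ⟨_, hm⟩)
  rw [← hp, ← map_mul, quotientRepr_mk, quotientRepr_mk]
  simp only
  rw [add_comm n d, coeff_monomial_mul, one_mul]

theorem homCoeff_eq_zero (hI : IsMonomialIdeal I) {m n d : Fin 3 →₀ ℕ}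
    (hm : monomial m (1 : ℂ) ∈ I) (hd : ¬ d ≤ n)
    (φ : ↥I →ₗ[MvPolynomial (Fin 3) ℂ] (MvPolynomial (Fin 3) ℂ ⧸ I)) :
    homCoeff hI (m + d) n φ = 0 := by
  by_cases hn : n ∈ standard I
  · have hmd := monomial_mem_of_le hm (le_add_of_nonneg_right (zero_le (a := d)))
    rw [homCoeff_apply hI hmd hn, hom_monomial_add hm]
    obtain ⟨p, hp⟩ := Ideal.Quotient.mk_surjective (φ ⟨_, hm⟩)
    rw [← hp, ← map_mul, quotientRepr_mk]
    simp only
    rw [coeff_monomial_mul', if_neg hd]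
  · simp [homCoeff, hn]

theorem hom_eq_zero (hI : IsMonomialIdeal I)
    {φ : ↥I →ₗ[MvPolynomial (Fin 3) ℂ] (MvPolynomial (Fin 3) ℂ ⧸ I)}
    (h : ∀ m n, monomial m (1 : ℂ) ∈ I → n ∈ standard I → homCoeff hI m n φ = 0) : φ = 0 := by
  have hmon : ∀ m, ∀ hm : monomial m (1 : ℂ) ∈ I, φ ⟨_, hm⟩ = 0 := by
    intro m hm
    apply (quotientRepr hI).injective
    ext n
    rw [map_zero, Finsupp.zero_apply, ← h m n hm n.2, homCoeff_apply hI hm n.2]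
  ext1 ⟨p, hp⟩
  have : (⟨p, hp⟩ : I) = ∑ d ∈ p.support.attach,
      (C (coeff d.1 p) : MvPolynomial (Fin 3) ℂ) • (⟨monomial d.1 1, hI p hp d.1 d.2⟩ : I) := by
    ext1
    rw [Submodule.coe_sum]
    change p = _
    conv_lhs => rw [p.as_sum, ← Finset.sum_attach]
    simp [C_mul_monomial]
  rw [this, map_sum, LinearMap.zero_apply]
  exact Finset.sum_eq_zero fun d _ => by rw [map_smul, hmon, smul_zero]

theorem hom_finite_and_finrank_le (hI : IsMonomialIdeal I)
    (L : List ((Fin 3 →₀ ℕ) × (Fin 3 →₀ ℕ)))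
    (h : ∀ φ : ↥I →ₗ[MvPolynomial (Fin 3) ℂ] (MvPolynomial (Fin 3) ℂ ⧸ I),
      (∀ q ∈ L, homCoeff hI q.1 q.2 φ = 0) → φ = 0) :
    Module.Finite ℂ (↥I →ₗ[MvPolynomial (Fin 3) ℂ] (MvPolynomial (Fin 3) ℂ ⧸ I)) ∧
      tangentDim I ≤ L.length := by
  let f : (↥I →ₗ[MvPolynomial (Fin 3) ℂ] (MvPolynomial (Fin 3) ℂ ⧸ I)) →ₗ[ℂ]
      (Fin L.length → ℂ) := LinearMap.pi fun i => homCoeff hI (L.get i).1 (L.get i).2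
  have hf : Function.Injective f := by
    rw [injective_iff_map_eq_zero]
    intro φ hφ
    refine h φ fun q hq => ?_
    obtain ⟨i, rfl⟩ := List.get_of_mem hq
    exact congrFun hφ i
  refine ⟨Module.Finite.of_injective f hf, ?_⟩
  simpa [tangentDim] using LinearMap.finrank_le_finrank_of_injective hf

/-- The linear map sending the monomial `m` to the sum of the classes of those `n` with
`(m, n) ∈ S`. -/
noncomputable def transport (I : Ideal (MvPolynomial (Fin 3) ℂ))
    (S : Finset ((Fin 3 →₀ ℕ) × (Fin 3 →₀ ℕ))) :
    MvPolynomial (Fin 3) ℂ →ₗ[ℂ] (MvPolynomial (Fin 3) ℂ ⧸ I) :=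
  ∑ q ∈ S, (lcoeff ℂ q.1).smulRight (Ideal.Quotient.mk I (monomial q.2 1))

theorem transport_apply (S : Finset ((Fin 3 →₀ ℕ) × (Fin 3 →₀ ℕ)))
    (p : MvPolynomial (Fin 3) ℂ) :
    transport I S p = ∑ q ∈ S, coeff q.1 p • Ideal.Quotient.mk I (monomial q.2 1) := by
  simp [transport, lcoeff]

/-- Pairs `(m, n)` with `m ∈ I`, `n ∉ I`, closed under multiplying and dividing both entries by a
variable, so that the indicator function of the set is the coefficient function of a
homomorphism `I → R / I`. -/
structure IsClosedSet (I : Ideal (MvPolynomial (Fin 3) ℂ))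
    (S : Finset ((Fin 3 →₀ ℕ) × (Fin 3 →₀ ℕ))) : Prop where
  up : ∀ q ∈ S, ∀ i : Fin 3, q.2 + Finsupp.single i 1 ∈ standard I →
    (q.1 + Finsupp.single i 1, q.2 + Finsupp.single i 1) ∈ S
  down : ∀ q ∈ S, ∀ (i : Fin 3) (m : Fin 3 →₀ ℕ), q.1 = m + Finsupp.single i 1 →
    monomial m (1 : ℂ) ∈ I → ∃ n, q.2 = n + Finsupp.single i 1 ∧ (m, n) ∈ S

theorem transport_X_mul (hI : IsMonomialIdeal I) {S : Finset ((Fin 3 →₀ ℕ) × (Fin 3 →₀ ℕ))}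
    (hS : IsClosedSet I S) (i : Fin 3) {p : MvPolynomial (Fin 3) ℂ} (hp : p ∈ I) :
    transport I S (X i * p) = Ideal.Quotient.mk I (X i) * transport I S p := by
  classical
  rw [transport_apply, transport_apply, Finset.mul_sum]
  symm
  refine Finset.sum_bij_ne_zero
    (fun q _ _ => (q.1 + Finsupp.single i 1, q.2 + Finsupp.single i 1)) ?_ ?_ ?_ ?_
  · intro q hq hne
    refine hS.up q hq i fun hmem => hne ?_
    rw [mul_smul_comm, ← map_mul, X, monomial_mul, mul_one, add_comm,
      Ideal.Quotient.eq_zero_iff_mem.2 hmem, smul_zero]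
  · rintro ⟨m, n⟩ _ _ ⟨m', n'⟩ _ _ h
    simpa using h
  · rintro ⟨m, n⟩ hq hne
    have hc : coeff m (X i * p) ≠ 0 := fun h => hne (by simp only [h, zero_smul])
    rw [X, coeff_monomial_mul'] at hc
    split_ifs at hc with hle
    · obtain ⟨m', rfl⟩ := exists_add_of_le hle
      rw [add_tsub_cancel_left, one_mul] at hc
      obtain ⟨n', hn', hmem⟩ := hS.down _ hq i m' (add_comm _ _)
        (hI p hp m' (mem_support_iff.2 hc))
      dsimp only at hn'
      subst hn'
      refine ⟨(m', n'), hmem, ?_, by rw [add_comm m']⟩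
      have : Ideal.Quotient.mk I (X i) * (coeff m' p • Ideal.Quotient.mk I (monomial n' 1)) =
          coeff (Finsupp.single i 1 + m') (X i * p) •
            Ideal.Quotient.mk I (monomial (n' + Finsupp.single i 1) 1) := by
        rw [coeff_X_mul, mul_smul_comm, ← map_mul, X, monomial_mul, mul_one, add_comm n']
      rw [this]
      exact hne
    · exact absurd rfl hc
  · rintro ⟨m, n⟩ _ _
    rw [add_comm m, coeff_X_mul, mul_smul_comm, ← map_mul, X, monomial_mul, mul_one, add_comm n]

theorem transport_mul (hI : IsMonomialIdeal I) {S : Finset ((Fin 3 →₀ ℕ) × (Fin 3 →₀ ℕ))}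
    (hS : IsClosedSet I S) (r : MvPolynomial (Fin 3) ℂ) :
    ∀ p ∈ I, transport I S (r * p) = Ideal.Quotient.mk I r * transport I S p := by
  induction r using MvPolynomial.induction_on with
  | C a =>
    intro p _
    rw [C_mul', map_smul]
    obtain ⟨t, ht⟩ := Ideal.Quotient.mk_surjective (transport I S p)
    rw [← ht, ← map_mul, C_mul']
    rfl
  | add r s hr hs =>
    intro p hp
    rw [add_mul, map_add, hr p hp, hs p hp, map_add, add_mul]
  | mul_X r i hr =>
    intro p hp
    rw [mul_assoc, hr _ (I.mul_mem_left _ hp), transport_X_mul hI hS i hp, map_mul, mul_assoc]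

/-- The homomorphism whose coefficient function is the indicator function of `S`. -/
noncomputable def closedHom (hI : IsMonomialIdeal I)
    {S : Finset ((Fin 3 →₀ ℕ) × (Fin 3 →₀ ℕ))} (hS : IsClosedSet I S) :
    ↥I →ₗ[MvPolynomial (Fin 3) ℂ] (MvPolynomial (Fin 3) ℂ ⧸ I) where
  toFun p := transport I S p
  map_add' _ _ := map_add _ _ _
  map_smul' r p := transport_mul hI hS r p p.2

theorem homCoeff_closedHom (hI : IsMonomialIdeal I)
    {S : Finset ((Fin 3 →₀ ℕ) × (Fin 3 →₀ ℕ))} (hS : IsClosedSet I S) {m n : Fin 3 →₀ ℕ}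
    (hm : monomial m (1 : ℂ) ∈ I) (hn : n ∈ standard I) [Decidable ((m, n) ∈ S)] :
    homCoeff hI m n (closedHom hI hS) = if (m, n) ∈ S then 1 else 0 := by
  classical
  rw [homCoeff_apply hI hm hn]
  change quotientRepr hI (transport I S (monomial m 1)) ⟨n, hn⟩ = _
  rw [transport_apply, map_sum, Finsupp.finsetSum_apply]
  simp only [map_smul, Finsupp.smul_apply, quotientRepr_mk, coeff_monomial, smul_eq_mul]
  trans ∑ q ∈ S, if q = (m, n) then (1 : ℂ) else 0
  swap
  · rw [Finset.sum_ite_eq']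
    congr
  refine Finset.sum_congr rfl fun q _ => ?_
  rcases q with ⟨m', n'⟩
  by_cases h1 : m = m' <;> by_cases h2 : n' = n <;> simp [h1, h2, Ne.symm]

theorem le_tangentDim (hI : IsMonomialIdeal I)
    [Module.Finite ℂ (↥I →ₗ[MvPolynomial (Fin 3) ℂ] (MvPolynomial (Fin 3) ℂ ⧸ I))]
    (k : ℕ) (q : Fin k → (Fin 3 →₀ ℕ) × (Fin 3 →₀ ℕ))
    (hq : ∀ j, monomial (q j).1 (1 : ℂ) ∈ I ∧ (q j).2 ∈ standard I)
    (S : Fin k → Finset ((Fin 3 →₀ ℕ) × (Fin 3 →₀ ℕ))) (hS : ∀ j, IsClosedSet I (S j))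
    (hqS : ∀ i j, q j ∈ S i ↔ i = j) : k ≤ tangentDim I := by
  classical
  let f : (↥I →ₗ[MvPolynomial (Fin 3) ℂ] (MvPolynomial (Fin 3) ℂ ⧸ I)) →ₗ[ℂ]
      (Fin k → ℂ) := LinearMap.pi fun j => homCoeff hI (q j).1 (q j).2
  have hf : f ∘ (fun i => closedHom hI (hS i)) = fun i => Pi.single i 1 := by
    funext i j
    change homCoeff hI (q j).1 (q j).2 (closedHom hI (hS i)) = _
    rw [homCoeff_closedHom hI (hS i) (hq j).1 (hq j).2, Pi.single_apply]
    simp only [Prod.mk.eta, hqS, eq_comm]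
  have hli : LinearIndependent ℂ (fun i => closedHom hI (hS i)) := by
    apply LinearIndependent.of_comp f
    rw [hf]
    convert (Pi.basisFun ℂ (Fin k)).linearIndependent with i
    simp
  simpa [tangentDim] using hli.fintype_card_le_finrank

end Hom

/-- Exponent vectors, in a form suited to kernel computation. -/
abbrev Expt := ℕ × ℕ × ℕ

namespace Expt

def add (s t : Expt) : Expt := (Nat.add s.1 t.1, Nat.add s.2.1 t.2.1, Nat.add s.2.2 t.2.2)

def sub (s t : Expt) : Expt := (Nat.sub s.1 t.1, Nat.sub s.2.1 t.2.1, Nat.sub s.2.2 t.2.2)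

def ble (s t : Expt) : Bool :=
  (Nat.ble s.1 t.1).and ((Nat.ble s.2.1 t.2.1).and (Nat.ble s.2.2 t.2.2))

/-- A linear functional used to order exponent vectors. -/
def code (t : Expt) : ℕ := Nat.add (Nat.mul 256 t.1) (Nat.add (Nat.mul 16 t.2.1) t.2.2)

theorem ble_iff {s t : Expt} : s.ble t = true ↔ s ≤ t := by
  simp [ble, Prod.le_def]

theorem sub_add {s t : Expt} (h : s.ble t = true) : (t.sub s).add s = t := by
  obtain ⟨h1, h2, h3⟩ := ble_iff.1 h
  exact Prod.ext (Nat.sub_add_cancel h1)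
    (Prod.ext (Nat.sub_add_cancel h2) (Nat.sub_add_cancel h3))

end Expt

/-- The exponents of the three variables. -/
def dirs : List Expt := [(1, 0, 0), (0, 1, 0), (0, 0, 1)]

theorem code_sub_lt {m d : Expt} (hd : d ∈ dirs) (h : d.ble m = true) :
    (m.sub d).code < m.code := by
  rw [Expt.ble_iff] at h
  obtain ⟨h1, h2, h3⟩ := h
  simp only [dirs, List.mem_cons, List.not_mem_nil, or_false] at hd
  rcases m with ⟨a, b, c⟩
  rcases hd with rfl | rfl | rfl <;>
    simp_all only [Expt.code, Expt.sub, Nat.add_eq, Nat.mul_eq, Nat.sub_eq] <;> omega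

/-! A finite-colength monomial ideal is encoded by a natural number `h` whose hexadecimal digit in
position `4 * a + b` is the least `c` such that `x ^ a * y ^ b * z ^ c` lies in the ideal. -/

def height (h a b : ℕ) : ℕ :=
  bif Nat.ble b 3 then Nat.land (Nat.shiftRight h (Nat.mul 4 (Nat.add (Nat.mul 4 a) b))) 15 else 0

def mem (h : ℕ) (t : Expt) : Bool := Nat.ble (height h t.1 t.2.1) t.2.2

theorem mem_iff {h a b c : ℕ} : mem h (a, b, c) = true ↔ height h a b ≤ c := by
  simp [mem]

def killed (h : ℕ) (m n : Expt) : Bool :=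
  dirs.any fun d => (d.ble m).and ((mem h (m.sub d)).and (d.ble n).not)

def visitUp (h : ℕ) (m n d : Expt) (l : List (Expt × Expt)) : List (Expt × Expt) :=
  bif mem h (n.add d) then l else (m.add d, n.add d) :: l

def visitDown (h : ℕ) (m n d : Expt) (l : List (Expt × Expt)) : List (Expt × Expt) :=
  bif (d.ble m).and ((mem h (m.sub d)).and (d.ble n)) then (m.sub d, n.sub d) :: l else l

/-- Prepends to `l` the pairs obtained from `(m, n)` by multiplying or dividing both monomials by
a variable. -/
def visit (h : ℕ) (m n : Expt) (l : List (Expt × Expt)) : List (Expt × Expt) :=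
  visitDown h m n (1, 0, 0) <| visitDown h m n (0, 1, 0) <| visitDown h m n (0, 0, 1) <|
  visitUp h m n (1, 0, 0) <| visitUp h m n (0, 1, 0) <| visitUp h m n (0, 0, 1) l

def isSeen (seen : ℕ) (m : Expt) : Bool :=
  Nat.beq (Nat.land 1 (Nat.shiftRight seen m.code)) 1

def markSeen (seen : ℕ) (m : Expt) : ℕ := Nat.lor seen (Nat.shiftLeft 1 m.code)

/-- Traverses a component of the graph of pairs `(m, n)`, and reports whether it found a pair at
which every coefficient function vanishes, or one with `m` of code below `k`. -/
def search (h k : ℕ) : ℕ → List (Expt × Expt) → ℕ → Bool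
  | 0, _, _ => false
  | _ + 1, [], _ => false
  | f + 1, p :: todo, seen =>
    bif isSeen seen p.1 then search h k f todo seen else
    (Nat.blt p.1.code k).or ((killed h p.1 p.2).or
      (search h k f (visit h p.1 p.2 todo) (markSeen seen p.1)))

def std (h : ℕ) : List Expt :=
  (List.range 3).flatMap fun a => (List.range 4).flatMap fun b =>
    (List.range (height h a b)).map fun c => (a, b, c)

def gens (h : ℕ) : List Expt :=
  ((List.range 4).flatMap fun a => (List.range 5).map fun b => (a, b, height h a b)).filter
    fun m => dirs.all fun d => ((d.ble m).and (mem h (m.sub d))).not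

def reps (h : ℕ) : List (Expt × Expt) :=
  (gens h).flatMap fun m => ((std h).filter fun n =>
    (search h m.code 96 [(m, n)] 0).not).map fun n => (m, n)

/-- The properties of `homCoeff` on which the upper bound rests. -/
structure IsCoeffFunction (h : ℕ) (c : Expt → Expt → ℂ) : Prop where
  mem_add : ∀ t d, mem h t = true → mem h (t.add d) = true
  add : ∀ m n d, mem h m = true → mem h (n.add d) = false → c (m.add d) (n.add d) = c m n
  zero : ∀ m n d, mem h m = true → d.ble n = false → c (m.add d) n = 0

namespace IsCoeffFunction

variable {h : ℕ} {c : Expt → Expt → ℂ}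

theorem mem_sub (hc : IsCoeffFunction h c) {n d : Expt} (hn : mem h n = false)
    (hd : d.ble n = true) : mem h (n.sub d) = false := by
  by_contra hmem
  have := hc.mem_add _ d (Bool.eq_true_of_not_eq_false hmem)
  rw [Expt.sub_add hd, hn] at this
  exact Bool.false_ne_true this

theorem killed_eq_zero (hc : IsCoeffFunction h c) {m n : Expt} (hk : killed h m n = true) :
    c m n = 0 := by
  obtain ⟨d, -, hd⟩ := List.any_eq_true.1 hk
  simp only [Bool.and_eq_true, Bool.not_eq_true'] at hd
  rw [← Expt.sub_add hd.1]
  exact hc.zero _ _ _ hd.2.1 hd.2.2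

/-- `p` is a pair of a monomial in the ideal and a standard monomial with coefficient `v`. -/
def HasValue (h : ℕ) (c : Expt → Expt → ℂ) (v : ℂ) (p : Expt × Expt) : Prop :=
  mem h p.1 = true ∧ mem h p.2 = false ∧ c p.1 p.2 = v

theorem hasValue_sub (hc : IsCoeffFunction h c) {v : ℂ} {m n d : Expt}
    (hp : HasValue h c v (m, n)) (hm : d.ble m = true) (hmd : mem h (m.sub d) = true)
    (hn : d.ble n = true) : HasValue h c v (m.sub d, n.sub d) := by
  refine ⟨hmd, hc.mem_sub hp.2.1 hn, ?_⟩
  have := hc.add (m.sub d) (n.sub d) d hmd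
  rw [Expt.sub_add hm, Expt.sub_add hn] at this
  exact (this hp.2.1).symm.trans hp.2.2

theorem hasValue_visitUp (hc : IsCoeffFunction h c) {v : ℂ} {m n d : Expt}
    {l : List (Expt × Expt)} (hp : HasValue h c v (m, n)) (hl : ∀ q ∈ l, HasValue h c v q) :
    ∀ q ∈ visitUp h m n d l, HasValue h c v q := by
  unfold visitUp
  cases hd : mem h (n.add d)
  · simp only [cond_false, List.forall_mem_cons]
    exact ⟨⟨hc.mem_add _ _ hp.1, hd, (hc.add _ _ _ hp.1 hd).trans hp.2.2⟩, hl⟩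
  · simpa using hl

theorem hasValue_visitDown (hc : IsCoeffFunction h c) {v : ℂ} {m n d : Expt}
    {l : List (Expt × Expt)} (hp : HasValue h c v (m, n)) (hl : ∀ q ∈ l, HasValue h c v q) :
    ∀ q ∈ visitDown h m n d l, HasValue h c v q := by
  unfold visitDown
  cases hd : (d.ble m).and ((mem h (m.sub d)).and (d.ble n))
  · simpa using hl
  · simp only [Bool.and_eq_true] at hd
    simp only [cond_true, List.forall_mem_cons]
    exact ⟨hc.hasValue_sub hp hd.1 hd.2.1 hd.2.2, hl⟩

theorem search_sound (hc : IsCoeffFunction h c) {v : ℂ} {k : ℕ} :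
    ∀ (f : ℕ) (todo : List (Expt × Expt)) (seen : ℕ), (∀ q ∈ todo, HasValue h c v q) →
      search h k f todo seen = true → v = 0 ∨ ∃ q, q.1.code < k ∧ HasValue h c v q
  | 0, _, _, _, hs => by simp [search] at hs
  | _ + 1, [], _, _, hs => by simp [search] at hs
  | f + 1, p :: todo, seen, ht, hs => by
    rw [List.forall_mem_cons] at ht
    rw [search] at hs
    cases hseen : isSeen seen p.1
    · rw [hseen, cond_false, Bool.or_eq_true, Bool.or_eq_true] at hs
      rcases hs with hs | hs | hs
      · exact Or.inr ⟨p, by simpa using hs, ht.1⟩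
      · exact Or.inl (ht.1.2.2.symm.trans (hc.killed_eq_zero hs))
      · refine search_sound hc f _ _ ?_ hs
        iterate 3 refine hc.hasValue_visitDown ht.1 ?_
        iterate 3 refine hc.hasValue_visitUp ht.1 ?_
        exact ht.2
    · rw [hseen, cond_true] at hs
      exact search_sound hc f _ _ ht.2 hs

theorem lt_of_mem_false (hc : IsCoeffFunction h c) (hx : mem h (3, 0, 0) = true) {n : Expt}
    (hn : mem h n = false) : n.1 < 3 ∧ n.2.1 < 4 ∧ n.2.2 < height h n.1 n.2.1 := by
  rcases n with ⟨a, b, z⟩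
  have hz : z < height h a b := by
    by_contra hz
    rw [mem_iff.2 (not_lt.1 hz)] at hn
    exact Bool.false_ne_true hn.symm
  refine ⟨?_, ?_, hz⟩
  · by_contra ha
    have := hc.mem_add _ (a - 3, b, z) hx
    simp only [Expt.add, Nat.add_eq, Nat.zero_add, Nat.add_sub_cancel' (not_lt.1 ha), hn] at this
    exact Bool.false_ne_true this
  · by_contra hb
    have h0 : height h a b = 0 := by
      have : Nat.ble b 3 = false := by
        rw [← Bool.not_eq_true, Nat.ble_eq]; dsimp only at hb; omega
      rw [height, this, cond_false]
    omega

theorem mem_std (hc : IsCoeffFunction h c) (hx : mem h (3, 0, 0) = true) {n : Expt}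
    (hn : mem h n = false) : n ∈ std h := by
  have := hc.lt_of_mem_false hx hn
  rcases n with ⟨a, b, z⟩
  simpa [std, and_assoc] using this

theorem mem_gens (hc : IsCoeffFunction h c) (hx : mem h (3, 0, 0) = true) {m : Expt}
    (hm : mem h m = true) (hmin : ∀ d ∈ dirs, d.ble m = true → mem h (m.sub d) = false) :
    m ∈ gens h := by
  rcases m with ⟨a, b, z⟩
  simp only [dirs, List.forall_mem_cons, List.not_mem_nil, IsEmpty.forall_iff, implies_true,
    and_true, Expt.ble_iff, Expt.sub, Nat.sub_eq, Prod.mk_le_mk, Nat.zero_le, true_and,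
    Nat.sub_zero] at hmin
  obtain ⟨h1, h2, h3⟩ := hmin
  have hz : z = height h a b := by
    have hle := mem_iff.1 hm
    by_contra hne
    have := hc.lt_of_mem_false hx (h3 (by omega))
    dsimp only at this
    omega
  have ha : a < 4 := by
    by_contra ha
    have := hc.lt_of_mem_false hx (h1 (by omega))
    dsimp only at this
    omega
  have hb : b < 5 := by
    by_contra hb
    have := hc.lt_of_mem_false hx (h2 (by omega))
    dsimp only at this
    omega
  rw [gens, List.mem_filter]
  constructor
  · simp [ha, hb, hz]
  · simp only [dirs, List.all_cons, List.all_nil, Bool.and_true, Bool.and_eq_true,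
      Bool.not_eq_true', Bool.and_eq_false_imp, Expt.ble_iff, Expt.sub, Nat.sub_eq, Prod.mk_le_mk,
      Nat.zero_le, true_and, and_true, Nat.sub_zero]
    exact ⟨h1, h2, h3⟩

theorem eq_zero_of_reps (hc : IsCoeffFunction h c) (hx : mem h (3, 0, 0) = true)
    (hr : ∀ q ∈ reps h, c q.1 q.2 = 0) (m n : Expt) (hm : mem h m = true)
    (hn : mem h n = false) : c m n = 0 := by
  induction hk : m.code using Nat.strong_induction_on generalizing m n with
  | _ k ih =>
  subst hk
  by_cases hmin : ∀ d ∈ dirs, d.ble m = true → mem h (m.sub d) = false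
  · cases hs : search h m.code 96 [(m, n)] 0
    · refine hr (m, n) ?_
      simp only [reps, List.mem_flatMap, List.mem_map, List.mem_filter]
      exact ⟨m, hc.mem_gens hx hm hmin, n, ⟨hc.mem_std hx hn, by simp [hs]⟩, rfl⟩
    · rcases hc.search_sound (v := c m n) 96 _ _ (by simp [HasValue, hm, hn]) hs with
        h0 | ⟨q, hq, hv⟩
      · exact h0
      · rw [← hv.2.2]
        exact ih _ hq _ _ hv.1 hv.2.1 rfl
  · push Not at hmin
    obtain ⟨d, hd, hle, hmem⟩ := hmin
    rw [ne_eq, Bool.not_eq_false] at hmem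
    cases hdn : d.ble n
    · rw [← Expt.sub_add hle]
      exact hc.zero _ _ _ hmem hdn
    · have hv := hc.hasValue_sub (v := c m n) ⟨hm, hn, rfl⟩ hle hmem hdn
      rw [← hv.2.2]
      exact ih _ (code_sub_lt hd hle) _ _ hv.1 hv.2.1 rfl

end IsCoeffFunction

noncomputable def expo (t : Expt) : Fin 3 →₀ ℕ :=
  Finsupp.equivFunOnFinite.symm ![t.1, t.2.1, t.2.2]

theorem expo_add (s t : Expt) : expo (s.add t) = expo s + expo t := by
  ext i
  fin_cases i <;> rfl

theorem expo_le {s t : Expt} : expo s ≤ expo t ↔ s.ble t = true := by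
  rw [Expt.ble_iff, Finsupp.le_def, Fin.forall_fin_succ, Fin.forall_fin_two]
  rfl

theorem exists_expo (d : Fin 3 →₀ ℕ) : ∃ t, expo t = d := by
  refine ⟨(d 0, d 1, d 2), ?_⟩
  ext i
  fin_cases i <;> rfl

theorem expo_injective : Function.Injective expo := by
  intro s t hst
  exact Prod.ext (DFunLike.congr_fun hst 0)
    (Prod.ext (DFunLike.congr_fun hst 1) (DFunLike.congr_fun hst 2))

theorem exists_expo_single (i : Fin 3) : ∃ d ∈ dirs, expo d = Finsupp.single i 1 := by
  have key : ∀ d : Expt, (∀ j, ![d.1, d.2.1, d.2.2] j = if i = j then 1 else 0) →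
      expo d = Finsupp.single i 1 := fun d hd => by
    ext j
    rw [Finsupp.single_apply]
    exact hd j
  fin_cases i
  · exact ⟨(1, 0, 0), by simp [dirs], key _ (by decide)⟩
  · exact ⟨(0, 1, 0), by simp [dirs], key _ (by decide)⟩
  · exact ⟨(0, 0, 1), by simp [dirs], key _ (by decide)⟩

/-- `h` encodes the monomials of the ideal `I`. -/
def HasTable (I : Ideal (MvPolynomial (Fin 3) ℂ)) (h : ℕ) : Prop :=
  ∀ t, monomial (expo t) (1 : ℂ) ∈ I ↔ mem h t = true

section HasTable

variable {I : Ideal (MvPolynomial (Fin 3) ℂ)} {h : ℕ}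

theorem HasTable.expo_mem_standard (hh : HasTable I h) {t : Expt} :
    expo t ∈ standard I ↔ mem h t = false := by
  rw [← Bool.not_eq_true, ← hh t]
  rfl

theorem isCoeffFunction_homCoeff (hI : IsMonomialIdeal I) (hh : HasTable I h)
    (φ : ↥I →ₗ[MvPolynomial (Fin 3) ℂ] (MvPolynomial (Fin 3) ℂ ⧸ I)) :
    IsCoeffFunction h fun m n => homCoeff hI (expo m) (expo n) φ where
  mem_add t d ht := by
    rw [← hh, expo_add]
    exact monomial_mem_of_le ((hh t).2 ht) (le_add_of_nonneg_right (zero_le (a := expo d)))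
  add m n d hm hn := by
    rw [expo_add, expo_add]
    exact homCoeff_add hI ((hh m).2 hm) (by rwa [← expo_add, hh.expo_mem_standard]) φ
  zero m n d hm hn := by
    rw [expo_add]
    refine homCoeff_eq_zero hI ((hh m).2 hm) ?_ φ
    rw [expo_le, hn]
    exact Bool.false_ne_true

theorem finite_and_tangentDim_le (hI : IsMonomialIdeal I) (hh : HasTable I h)
    (hx : mem h (3, 0, 0) = true) :
    Module.Finite ℂ (↥I →ₗ[MvPolynomial (Fin 3) ℂ] (MvPolynomial (Fin 3) ℂ ⧸ I)) ∧
      tangentDim I ≤ (reps h).length := by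
  generalize hL : reps h = L
  rw [← List.length_map (as := L) (fun q : Expt × Expt => (expo q.1, expo q.2))]
  refine hom_finite_and_finrank_le hI _ fun φ hφ => hom_eq_zero hI fun m n hm hn => ?_
  obtain ⟨m, rfl⟩ := exists_expo m
  obtain ⟨n, rfl⟩ := exists_expo n
  refine (isCoeffFunction_homCoeff hI hh φ).eq_zero_of_reps hx (fun q hq => ?_) m n
    ((hh m).1 hm) (hh.expo_mem_standard.1 hn)
  exact hφ (expo q.1, expo q.2) (List.mem_map_of_mem (hL ▸ hq))

end HasTable

/-- The component of the graph of pairs `(m, n)` through the pairs in the second argument. -/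
def component (h : ℕ) : ℕ → List (Expt × Expt) → ℕ → List (Expt × Expt)
  | 0, _, _ => []
  | _ + 1, [], _ => []
  | f + 1, p :: todo, seen =>
    bif isSeen seen p.1 then component h f todo seen else
    p :: component h f (visit h p.1 p.2 todo) (markSeen seen p.1)

def isClosedList (h : ℕ) (l : List (Expt × Expt)) : Bool :=
  l.all fun q => dirs.all fun d =>
    ((mem h (q.2.add d)).or (decide ((q.1.add d, q.2.add d) ∈ l))).and
    (((d.ble q.1).and (mem h (q.1.sub d))).not.or
      ((d.ble q.2).and (decide ((q.1.sub d, q.2.sub d) ∈ l))))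

def comp (h : ℕ) (p : Expt × Expt) : List (Expt × Expt) := component h 96 [p] 0

/-- Each pair of `l` lies in a closed component, and the components are distinct. -/
structure Separated (h : ℕ) (l : List (Expt × Expt)) : Prop where
  mem_std : ∀ p ∈ l, mem h p.1 = true ∧ mem h p.2 = false
  closed : ∀ p ∈ l, isClosedList h (comp h p) = true
  self_mem : ∀ p ∈ l, p ∈ comp h p
  pairwise : l.Pairwise fun p q => p ∉ comp h q ∧ q ∉ comp h p

section LowerBound

variable {I : Ideal (MvPolynomial (Fin 3) ℂ)} {h : ℕ}

noncomputable def expoPair : Expt × Expt ↪ (Fin 3 →₀ ℕ) × (Fin 3 →₀ ℕ) :=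
  ⟨Prod.map expo expo, expo_injective.prodMap expo_injective⟩

theorem isClosedSet_of_isClosedList (hh : HasTable I h) {l : List (Expt × Expt)}
    (hl : isClosedList h l = true) : IsClosedSet I (l.toFinset.map expoPair) := by
  simp only [isClosedList, List.all_eq_true, Bool.and_eq_true, Bool.or_eq_true,
    Bool.not_eq_true', Bool.and_eq_false_imp, decide_eq_true_eq] at hl
  have hmem : ∀ q : Expt × Expt, expoPair q ∈ l.toFinset.map expoPair ↔ q ∈ l := fun q => by
    rw [Finset.mem_map', List.mem_toFinset]
  constructor
  · intro q hq i hi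
    obtain ⟨q, hq', rfl⟩ := Finset.mem_map.1 hq
    rw [List.mem_toFinset] at hq'
    obtain ⟨d, hd, hdi⟩ := exists_expo_single i
    rw [← hdi] at hi ⊢
    change expo q.2 + expo d ∈ _ at hi
    rw [← expo_add, hh.expo_mem_standard] at hi
    have := (hl q hq' d hd).1.resolve_left (by simp [hi])
    rw [← hmem] at this
    rw [show expoPair (q.1.add d, q.2.add d) = (expo q.1 + expo d, expo q.2 + expo d) from
      Prod.ext (expo_add _ _) (expo_add _ _)] at this
    exact this
  · intro q hq i m hm hmI
    obtain ⟨q, hq', rfl⟩ := Finset.mem_map.1 hq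
    rw [List.mem_toFinset] at hq'
    obtain ⟨d, hd, hdi⟩ := exists_expo_single i
    obtain ⟨m, rfl⟩ := exists_expo m
    rw [← hdi] at hm ⊢
    change expo q.1 = expo m + expo d at hm
    rw [← expo_add] at hm
    have hle : d.ble q.1 = true := by
      rw [expo_injective hm, ← expo_le, expo_add]
      exact le_add_of_nonneg_left (zero_le (a := expo m))
    have hsub : q.1.sub d = m := by
      apply expo_injective
      apply add_right_cancel (b := expo d)
      rw [← expo_add, ← expo_add, Expt.sub_add hle, ← expo_injective hm]
    have := (hl q hq' d hd).2.resolve_left fun hn => by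
      have := hn hle
      rw [hsub, (hh m).1 hmI] at this
      exact Bool.false_ne_true this.symm
    refine ⟨expo (q.2.sub d), ?_, ?_⟩
    · rw [← expo_add, Expt.sub_add this.1]
      rfl
    · have h2 := this.2
      rw [hsub, ← hmem] at h2
      exact h2

theorem length_le_tangentDim (hI : IsMonomialIdeal I) (hh : HasTable I h)
    [Module.Finite ℂ (↥I →ₗ[MvPolynomial (Fin 3) ℂ] (MvPolynomial (Fin 3) ℂ ⧸ I))]
    {l : List (Expt × Expt)} (hl : Separated h l) : l.length ≤ tangentDim I := by
  refine le_tangentDim hI l.length (fun j => expoPair (l.get j)) (fun j => ?_)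
    (fun j => (comp h (l.get j)).toFinset.map expoPair)
    (fun j => isClosedSet_of_isClosedList hh (hl.closed _ (l.get_mem j))) fun i j => ?_
  · have := hl.mem_std _ (l.get_mem j)
    exact ⟨(hh _).2 this.1, hh.expo_mem_standard.2 this.2⟩
  · rw [Finset.mem_map', List.mem_toFinset]
    have hp := List.pairwise_iff_get.1 hl.pairwise
    constructor
    · intro hij
      rcases lt_trichotomy i j with hlt | heq | hlt
      · exact absurd hij (hp i j hlt).2
      · exact heq
      · exact absurd hij (hp j i hlt).1
    · rintro rfl
      exact hl.self_mem _ (l.get_mem i)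

end LowerBound

section TableIdeal

/-- The height inequalities characterizing the encodings of Borel-fixed ideals. -/
structure IsBorelTable (h : ℕ) : Prop where
  lt : h < 2 ^ 48
  height_le : ∀ a < 3, ∀ b < 4, height h a (b + 1) ≤ height h a b - 1 ∧
    height h (a + 1) b ≤ height h a (b + 1)

variable {h : ℕ}

theorem height_eq_zero (hlt : h < 2 ^ 48) {a b : ℕ} (hab : 3 ≤ a ∨ 4 ≤ b) : height h a b = 0 := by
  unfold height
  by_cases hb : b < 4
  · have ha : 3 ≤ a := by omega
    have : Nat.shiftRight h (Nat.mul 4 (Nat.add (Nat.mul 4 a) b)) = 0 := by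
      change h >>> (4 * (4 * a + b)) = 0
      rw [Nat.shiftRight_eq_div_pow]
      exact Nat.div_eq_of_lt (hlt.trans_le (Nat.pow_le_pow_right two_pos (by omega)))
    rw [this]
    cases Nat.ble b 3 <;> rfl
  · have : Nat.ble b 3 = false := by
      rw [← Bool.not_eq_true, Nat.ble_eq]
      omega
    rw [this, cond_false]

theorem IsBorelTable.height_succ_right (hh : IsBorelTable h) (a b : ℕ) :
    height h a (b + 1) ≤ height h a b - 1 := by
  by_cases hab : a < 3 ∧ b < 4
  · exact (hh.height_le a hab.1 b hab.2).1
  · rw [height_eq_zero hh.lt (by omega)]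
    exact Nat.zero_le _

theorem IsBorelTable.height_succ_left (hh : IsBorelTable h) (a b : ℕ) :
    height h (a + 1) b ≤ height h a (b + 1) := by
  by_cases hab : a < 3 ∧ b < 4
  · exact (hh.height_le a hab.1 b hab.2).2
  · rw [height_eq_zero hh.lt (by omega)]
    exact Nat.zero_le _

theorem IsBorelTable.mem_of_le (hh : IsBorelTable h) {s t : Expt} (hst : s ≤ t)
    (hs : mem h s = true) : mem h t = true := by
  rcases s with ⟨a, b, c⟩
  rcases t with ⟨a', b', c'⟩
  obtain ⟨h1, h2, h3⟩ := hst
  dsimp only at h1 h2 h3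
  rw [mem_iff] at hs ⊢
  have e1 : height h a' b ≤ height h a b :=
    antitone_nat_of_succ_le (f := fun a => height h a b)
      (fun n => (hh.height_succ_left n b).trans ((hh.height_succ_right n b).trans
        (Nat.sub_le _ _))) h1
  have e2 : height h a' b' ≤ height h a' b :=
    antitone_nat_of_succ_le (f := fun b => height h a' b)
      (fun n => (hh.height_succ_right a' n).trans (Nat.sub_le _ _)) h2
  omega

/-- The monomial ideal encoded by `h`. -/
noncomputable def tableIdeal (h : ℕ) : Ideal (MvPolynomial (Fin 3) ℂ) :=
  Ideal.span ((fun d => monomial d (1 : ℂ)) '' (expo '' {t | mem h t = true}))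

theorem isMonomialIdeal_tableIdeal : IsMonomialIdeal (tableIdeal h) := by
  intro p hp d hd
  rw [tableIdeal, mem_ideal_span_monomial_image] at hp ⊢
  intro d' hd'
  obtain rfl : d' = d := by
    simpa using support_monomial_subset hd'
  exact hp d' hd

theorem hasTable_tableIdeal (hh : IsBorelTable h) : HasTable (tableIdeal h) h := by
  intro t
  constructor
  · intro ht
    rw [tableIdeal, mem_ideal_span_monomial_image] at ht
    obtain ⟨_, ⟨s, hs, rfl⟩, hle⟩ := ht (expo t) (by simp)
    exact hh.mem_of_le (Expt.ble_iff.1 (expo_le.1 hle)) hs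
  · intro ht
    exact Ideal.subset_span ⟨_, ⟨t, ht, rfl⟩, rfl⟩

theorem expo_exchange {s t : Expt} {i j : Fin 3}
    (h0 : s.1 = t.1 + Finsupp.single i 1 0 - Finsupp.single j 1 0)
    (h1 : s.2.1 = t.2.1 + Finsupp.single i 1 1 - Finsupp.single j 1 1)
    (h2 : s.2.2 = t.2.2 + Finsupp.single i 1 2 - Finsupp.single j 1 2) :
    expo t + Finsupp.single i 1 - Finsupp.single j 1 = expo s := by
  ext k
  fin_cases k
  · exact h0.symm
  · exact h1.symm
  · exact h2.symm

theorem isBorelFixed_tableIdeal (hh : IsBorelTable h) : IsBorelFixed (tableIdeal h) := by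
  intro d hd i j hij hdj
  obtain ⟨⟨a, b, c⟩, rfl⟩ := exists_expo d
  have hmem := mem_iff.1 ((hasTable_tableIdeal hh _).1 hd)
  have hl := hh.height_succ_left
  have hr := hh.height_succ_right
  fin_cases i <;> fin_cases j <;> try exact absurd hij (by decide)
  · change 0 < b at hdj
    obtain ⟨b, rfl⟩ := Nat.exists_eq_succ_of_ne_zero hdj.ne'
    rw [expo_exchange (s := (a + 1, b, c)) (by simp) (by simp) (by simp),
      hasTable_tableIdeal hh, mem_iff]
    exact (hl a b).trans hmem
  · change 0 < c at hdj
    rw [expo_exchange (s := (a + 1, b, c - 1)) (by simp) (by simp) (by simp),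
      hasTable_tableIdeal hh, mem_iff]
    have := hl a b
    have := hr a b
    omega
  · change 0 < c at hdj
    rw [expo_exchange (s := (a, b + 1, c - 1)) (by simp) (by simp) (by simp),
      hasTable_tableIdeal hh, mem_iff]
    have := hr a b
    omega

theorem finrank_tableIdeal (hh : IsBorelTable h) (hnodup : (std h).Nodup) :
    Module.finrank ℂ (MvPolynomial (Fin 3) ℂ ⧸ tableIdeal h) = (std h).length := by
  rw [finrank_quotient isMonomialIdeal_tableIdeal, Nat.card_coe_set_eq]
  have : standard (tableIdeal h) = ((std h).toFinset.map ⟨expo, expo_injective⟩ : Finset _) := by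
    ext d
    obtain ⟨⟨a, b, c⟩, rfl⟩ := exists_expo d
    rw [(hasTable_tableIdeal hh).expo_mem_standard, Finset.mem_coe]
    change _ ↔ (⟨expo, expo_injective⟩ : Expt ↪ _) (a, b, c) ∈ _
    rw [Finset.mem_map', List.mem_toFinset, ← Bool.not_eq_true, mem_iff, not_le]
    constructor
    · intro hc
      by_cases hab : a < 3 ∧ b < 4
      · simp [std, hab.1, hab.2, hc]
      · rw [height_eq_zero hh.lt (by omega)] at hc
        exact absurd hc (Nat.not_lt_zero _)
    · intro hmem
      simp only [std, List.mem_flatMap, List.mem_map, List.mem_range, Prod.mk.injEq] at hmem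
      obtain ⟨a', -, b', -, c', hc', rfl, rfl, rfl⟩ := hmem
      exact hc'
  rw [this, Set.ncard_coe_finset, Finset.card_map, List.toFinset_card_of_nodup hnodup]

theorem X_zero_pow (k : ℕ) :
    (X 0 : MvPolynomial (Fin 3) ℂ) ^ k = monomial (expo (k, 0, 0)) 1 := by
  have : Finsupp.single 0 k = expo (k, 0, 0) := by
    ext i
    fin_cases i <;> simp [expo]
  rw [X_pow_eq_monomial, this]

theorem tangentDim_tableIdeal (hh : IsBorelTable h) (hs : Separated h (reps h)) :
    tangentDim (tableIdeal h) = (reps h).length := by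
  have ht := hasTable_tableIdeal hh
  have hu := finite_and_tangentDim_le isMonomialIdeal_tableIdeal ht
    (mem_iff.2 (height_eq_zero hh.lt (Or.inl le_rfl)).le)
  have := hu.1
  exact hu.2.antisymm (length_le_tangentDim isMonomialIdeal_tableIdeal ht hs)

theorem mem_of_table {l m1 T : ℕ} (hh : IsBorelTable h) (hs : Separated h (reps h))
    (hnodup : (std h).Nodup) (hl : (std h).length = l) (hm1 : mem h (m1, 0, 0) = true)
    (hm1' : mem h (m1 - 1, 0, 0) = false) (hT : (reps h).length = T) :
    ∃ I : Ideal (MvPolynomial (Fin 3) ℂ),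
      IsMonomialIdeal I ∧ IsBorelFixed I ∧
      Module.finrank ℂ (MvPolynomial (Fin 3) ℂ ⧸ I) = l ∧
      (X 0 : MvPolynomial (Fin 3) ℂ) ^ m1 ∈ I ∧
      (X 0 : MvPolynomial (Fin 3) ℂ) ^ (m1 - 1) ∉ I ∧
      T = tangentDim I := by
  have ht := hasTable_tableIdeal hh
  refine ⟨tableIdeal h, isMonomialIdeal_tableIdeal, isBorelFixed_tableIdeal hh,
    (finrank_tableIdeal hh hnodup).trans hl, ?_, ?_,
    hT.symm.trans (tangentDim_tableIdeal hh hs).symm⟩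
  · rw [X_zero_pow, ht]
    exact hm1
  · rw [X_zero_pow, ht, hm1']
    exact Bool.false_ne_true

theorem isBorelTable_of_m1_eq_two : IsBorelTable 1245493 :=
  ⟨by decide +kernel, by decide +kernel⟩

theorem isBorelTable_of_m1_eq_three : IsBorelTable 4296212788 :=
  ⟨by decide +kernel, by decide +kernel⟩

theorem separated_of_m1_eq_two : Separated 1245493 (reps 1245493) where
  mem_std := by decide +kernel
  closed := by decide +kernel
  self_mem := by decide +kernel
  pairwise := by decide +kernel

theorem separated_of_m1_eq_three : Separated 4296212788 (reps 4296212788) where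
  mem_std := by decide +kernel
  closed := by decide +kernel
  self_mem := by decide +kernel
  pairwise := by decide +kernel

end TableIdeal

section Classification

/-- `f a b` is the least `c` such that `x ^ a * y ^ b * z ^ c` lies in `I`. -/
def IsHeight (I : Ideal (MvPolynomial (Fin 3) ℂ)) (f : ℕ → ℕ → ℕ) : Prop :=
  ∀ a b c, monomial (expo (a, b, c)) (1 : ℂ) ∈ I ↔ f a b ≤ c

variable {I : Ideal (MvPolynomial (Fin 3) ℂ)} {f : ℕ → ℕ → ℕ}

theorem exists_isHeight (hfin : (standard I).Finite) : ∃ f, IsHeight I f := by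
  have hex : ∀ a b, ∃ c, monomial (expo (a, b, c)) (1 : ℂ) ∈ I := by
    intro a b
    by_contra! hall
    have hinj : Function.Injective fun c : ℕ => expo (a, b, c) := fun c c' h => by
      simpa using expo_injective h
    exact Set.infinite_range_of_injective hinj (hfin.subset (Set.range_subset_iff.2 hall))
  classical
  refine ⟨fun a b => Nat.find (hex a b), fun a b c => ⟨Nat.find_min' (hex a b), fun hc => ?_⟩⟩
  refine monomial_mem_of_le (Nat.find_spec (hex a b)) (expo_le.2 (Expt.ble_iff.2 ?_))
  exact ⟨le_rfl, le_rfl, hc⟩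

theorem IsHeight.succ_right (hf : IsHeight I f) (hB : IsBorelFixed I) (a b : ℕ) :
    f a (b + 1) ≤ f a b - 1 := by
  rw [← hf]
  rcases Nat.eq_zero_or_pos (f a b) with h0 | hpos
  · refine monomial_mem_of_le ((hf a b (f a b - 1)).2 (by omega)) (expo_le.2 (Expt.ble_iff.2 ?_))
    exact ⟨le_rfl, Nat.le_succ b, le_rfl⟩
  · have := hB _ ((hf a b (f a b)).2 le_rfl) 1 2 (by decide) hpos
    rwa [expo_exchange (s := (a, b + 1, f a b - 1)) (by simp) (by simp) (by simp)] at this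

theorem IsHeight.succ_left (hf : IsHeight I f) (hB : IsBorelFixed I) (a b : ℕ) :
    f (a + 1) b ≤ f a (b + 1) := by
  rw [← hf]
  have := hB _ ((hf a (b + 1) _).2 le_rfl) 0 1 (by decide) (Nat.succ_pos b)
  rwa [expo_exchange (s := (a + 1, b, f a (b + 1))) (by simp) (by simp) (by simp)] at this

/-- The exponents lying below `f` over the index set `s`. -/
noncomputable def below (f : ℕ → ℕ → ℕ) (s : Finset (ℕ × ℕ)) : Finset (Fin 3 →₀ ℕ) :=
  (s.sigma fun p => Finset.range (f p.1 p.2)).map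
    ⟨fun t => expo (t.1.1, t.1.2, t.2), fun t t' h => by
      have := expo_injective h
      rcases t with ⟨⟨a, b⟩, c⟩
      rcases t' with ⟨⟨a', b'⟩, c'⟩
      simp_all⟩

theorem card_below (f : ℕ → ℕ → ℕ) (s : Finset (ℕ × ℕ)) :
    (below f s).card = ∑ p ∈ s, f p.1 p.2 := by
  simp [below, Finset.card_sigma]

theorem expo_mem_below {s : Finset (ℕ × ℕ)} {a b c : ℕ} :
    expo (a, b, c) ∈ below f s ↔ (a, b) ∈ s ∧ c < f a b := by
  rw [below, Finset.mem_map]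
  constructor
  · rintro ⟨⟨⟨a', b'⟩, c'⟩, ht, he⟩
    have := expo_injective he
    simp_all
  · rintro ⟨hs, hc⟩
    exact ⟨⟨(a, b), c⟩, by simp [hs, hc], rfl⟩

theorem IsHeight.expo_mem_standard (hf : IsHeight I f) {a b c : ℕ} :
    expo (a, b, c) ∈ standard I ↔ c < f a b := by
  rw [← not_le, ← hf]
  rfl

theorem IsHeight.sum_le (hf : IsHeight I f) (hfin : (standard I).Finite) (s : Finset (ℕ × ℕ)) :
    ∑ p ∈ s, f p.1 p.2 ≤ Nat.card (standard I) := by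
  rw [← card_below, ← Set.ncard_coe_finset, Nat.card_coe_set_eq]
  refine Set.ncard_le_ncard (fun d hd => ?_) hfin
  obtain ⟨⟨a, b, c⟩, rfl⟩ := exists_expo d
  exact hf.expo_mem_standard.2 (expo_mem_below.1 hd).2

theorem IsHeight.sum_eq (hf : IsHeight I f) (s : Finset (ℕ × ℕ))
    (hs : ∀ a b, (a, b) ∉ s → f a b = 0) :
    ∑ p ∈ s, f p.1 p.2 = Nat.card (standard I) := by
  rw [← card_below, ← Set.ncard_coe_finset, Nat.card_coe_set_eq]
  congr 1
  ext d
  obtain ⟨⟨a, b, c⟩, rfl⟩ := exists_expo d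
  rw [Finset.mem_coe, expo_mem_below, hf.expo_mem_standard, and_iff_right_iff_imp]
  intro hc
  by_contra hab
  rw [hs a b hab] at hc
  exact Nat.not_lt_zero _ hc

def encode (a0 a1 a2 a3 b0 b1 b2 c0 c1 : ℕ) : ℕ :=
  a0 + 16 * a1 + 256 * a2 + 4096 * a3 + 65536 * (b0 + 16 * b1 + 256 * b2)
    + 4294967296 * (c0 + 16 * c1)

theorem height_eq_mod {h a b : ℕ} (hb : b < 4) :
    height h a b = h / 2 ^ (4 * (4 * a + b)) % 16 := by
  have : Nat.ble b 3 = true := Nat.ble_eq_true_of_le (by omega)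
  rw [height, this, cond_true]
  change (h >>> (4 * (4 * a + b))) &&& (2 ^ 4 - 1) = _
  rw [Nat.and_two_pow_sub_one_eq_mod, Nat.shiftRight_eq_div_pow]

theorem height_encode (h00 : f 0 0 < 16) (h01 : f 0 1 < 16) (h02 : f 0 2 < 16)
    (h03 : f 0 3 < 16) (h10 : f 1 0 < 16) (h11 : f 1 1 < 16) (h12 : f 1 2 < 16) (h20 : f 2 0 < 16)
    (h21 : f 2 1 < 16) (hzero : ∀ a b, 3 ≤ a ∨ 4 ≤ b → f a b = 0) (h13 : f 1 3 = 0)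
    (h22 : f 2 2 = 0) (h23 : f 2 3 = 0) (a b : ℕ) :
    height (encode (f 0 0) (f 0 1) (f 0 2) (f 0 3) (f 1 0) (f 1 1) (f 1 2) (f 2 0) (f 2 1)) a b =
      f a b := by
  by_cases hab : a < 3 ∧ b < 4
  · obtain ⟨ha, hb⟩ := hab
    rw [height_eq_mod hb, encode]
    clear hzero
    interval_cases a <;> interval_cases b <;>
      simp only [Nat.reduceMul, Nat.reduceAdd, Nat.reducePow] <;> omega
  · rw [hzero a b (by omega), height_eq_zero _ (by omega)]
    unfold encode
    omega

/-- An upper bound for the tangent space dimension in terms of the heights at `x` and `x ^ 2`. -/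
def bound (b0 c0 : ℕ) : ℕ := bif Nat.beq b0 0 then 39 else bif Nat.beq c0 0 then 61 else 69

/-- Verifies `bound` for all Borel-fixed ideals of colength `13` containing `x ^ 3`. -/
def checkBound : Bool :=
  (List.range 14).all fun a0 => (List.range (max a0 1)).all fun a1 =>
  (List.range (max a1 1)).all fun a2 => (List.range (max a2 1)).all fun a3 =>
  Nat.ble 14 (a0 + a1 + a2 + a3) ||
  (List.range (a1 + 1)).all fun b0 => (List.range (min (max b0 1) (a2 + 1))).all fun b1 =>
  (List.range (min (max b1 1) (a3 + 1))).all fun b2 =>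
  (List.range (b1 + 1)).all fun c0 => (List.range (min (max c0 1) (b2 + 1))).all fun c1 =>
  !(Nat.beq (a0 + a1 + a2 + a3 + b0 + b1 + b2 + c0 + c1) 13) ||
    Nat.ble (reps (encode a0 a1 a2 a3 b0 b1 b2 c0 c1)).length (bound b0 c0)

theorem checkBound_eq_true : checkBound = true := by decide +kernel

theorem IsHeight.exists_table (hf : IsHeight I f) (hB : IsBorelFixed I)
    (hcard : Nat.card (standard I) = 13) (hx : f 3 0 = 0) :
    ∃ h, HasTable I h ∧ mem h (3, 0, 0) = true ∧ (reps h).length ≤ bound (f 1 0) (f 2 0) := by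
  have hfin : (standard I).Finite := Nat.finite_of_card_ne_zero (by omega)
  have hr := hf.succ_right hB
  have hl := hf.succ_left hB
  have hsum0 := hf.sum_le hfin ({0} ×ˢ Finset.range 5)
  simp only [Finset.sum_product, Finset.sum_range_succ, Finset.sum_singleton, Finset.range_zero,
    Finset.sum_empty] at hsum0
  have r00 := hr 0 0
  have r01 := hr 0 1
  have r02 := hr 0 2
  have r03 := hr 0 3
  have r10 := hr 1 0
  have r11 := hr 1 1
  have r20 := hr 2 0
  have l00 := hl 0 0
  have l01 := hl 0 1
  have l02 := hl 0 2
  have l03 := hl 0 3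
  have l10 := hl 1 0
  have l11 := hl 1 1
  have l12 := hl 1 2
  have l13 := hl 1 3
  have r13 := hr 1 3
  simp only [Nat.reduceAdd, zero_add] at r00 r01 r02 r03 r10 r11 r13 r20 hsum0
  simp only [Nat.reduceAdd, zero_add] at l00 l01 l02 l03 l10 l11 l12 l13
  have z04 : f 0 4 = 0 := by omega
  have hzero : ∀ a b, 3 ≤ a ∨ 4 ≤ b → f a b = 0 := by
    have hrow : ∀ a b k, f a b = 0 → f a (b + k) = 0 := by
      intro a b k h0
      induction k with
      | zero => exact h0
      | succ k ih => exact Nat.le_zero.1 ((hr a (b + k)).trans (by omega))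
    have hcol : ∀ a b k, f a b = 0 → f (a + k) b = 0 := by
      intro a b k h0
      induction k with
      | zero => exact h0
      | succ k ih => exact Nat.le_zero.1 ((hl (a + k) b).trans ((hr (a + k) b).trans (by omega)))
    rintro a b (h | h)
    · have := hcol 3 b (a - 3) (by simpa using hrow 3 0 b hx)
      rwa [Nat.add_sub_cancel' h] at this
    · have := hrow a 4 (b - 4) (by simpa using hcol 0 4 a z04)
      rwa [Nat.add_sub_cancel' h] at this
  have hsum := hf.sum_eq (Finset.range 3 ×ˢ Finset.range 4) fun a b hab => by
    rw [Finset.mem_product, Finset.mem_range, Finset.mem_range] at hab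
    exact hzero a b (by omega)
  simp only [Finset.sum_product, Finset.sum_range_succ, Finset.range_zero,
    Finset.sum_empty, zero_add] at hsum
  have z13 : f 1 3 = 0 := by omega
  have z22 : f 2 2 = 0 := by omega
  have z23 : f 2 3 = 0 := by omega
  have hheight := height_encode (f := f) (by omega) (by omega) (by omega) (by omega)
    (by omega) (by omega) (by omega) (by omega) (by omega) hzero z13 z22 z23
  refine ⟨_, fun t => ?_, mem_iff.2 ((hheight 3 0).trans hx).le, ?_⟩
  · rw [mem_iff, hheight]
    exact hf _ _ _
  · have key := checkBound_eq_true
    simp only [checkBound, List.all_eq_true, List.mem_range, Bool.or_eq_true, Nat.ble_eq,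
      Bool.not_eq_true'] at key
    have k1 := key (f 0 0) (by omega) (f 0 1) (by omega) (f 0 2) (by omega) (f 0 3) (by omega)
    have k2 := k1.resolve_left (by omega) (f 1 0) (by omega) (f 1 1) (by omega) (f 1 2) (by omega)
      (f 2 0) (by omega) (f 2 1) (by omega)
    refine k2.resolve_left ?_
    rw [Bool.not_eq_false, Nat.beq_eq]
    omega

theorem tangentDim_le (hI : IsMonomialIdeal I) (hB : IsBorelFixed I)
    (hcard : Module.finrank ℂ (MvPolynomial (Fin 3) ℂ ⧸ I) = 13) {m1 : ℕ}
    (hx : (X 0 : MvPolynomial (Fin 3) ℂ) ^ m1 ∈ I) :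
    (m1 = 1 → tangentDim I ≤ 39) ∧ (m1 = 2 → tangentDim I ≤ 61) ∧ (m1 = 3 → tangentDim I ≤ 69) := by
  rw [finrank_quotient hI] at hcard
  obtain ⟨f, hf⟩ := exists_isHeight (Nat.finite_of_card_ne_zero (hcard.trans_ne (by decide)))
  rw [X_zero_pow, hf, Nat.le_zero] at hx
  have hmono : ∀ a, f a 0 = 0 → f (a + 1) 0 = 0 := fun a ha =>
    Nat.le_zero.1 ((hf.succ_left hB a 0).trans ((hf.succ_right hB a 0).trans (by omega)))
  have key : f 3 0 = 0 → tangentDim I ≤ bound (f 1 0) (f 2 0) := fun h3 => by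
    obtain ⟨h, hh, hmem, hle⟩ := hf.exists_table hB hcard h3
    exact (finite_and_tangentDim_le hI hh hmem).2.trans hle
  refine ⟨?_, ?_, ?_⟩ <;> rintro rfl
  · exact (key (hmono 2 (hmono 1 hx))).trans (by simp [bound, hx])
  · refine (key (hmono 2 hx)).trans ?_
    rw [hx]
    cases h : Nat.beq (f 1 0) 0 <;> simp [bound, h]
  · refine (key hx).trans ?_
    cases h : Nat.beq (f 1 0) 0 <;> cases h' : Nat.beq (f 2 0) 0 <;> simp [bound, h, h']

end Classification

end BorelTangent

theorem Tmax_monotonicity_l13 :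
    TmaxEq 13 2 61 ∧
    TmaxEq 13 3 69 ∧
    (∀ T1 T2 T3 : ℕ, TmaxEq 13 1 T1 → TmaxEq 13 2 T2 → TmaxEq 13 3 T3 →
      T1 < T2 ∧ T2 < T3) := by
  have h2 : TmaxEq 13 2 61 := by
    refine ⟨BorelTangent.mem_of_table BorelTangent.isBorelTable_of_m1_eq_two
      BorelTangent.separated_of_m1_eq_two (by decide +kernel) (by decide +kernel)
      (by decide +kernel) (by decide +kernel) (by decide +kernel), ?_⟩
    rintro _ ⟨I, hI, hB, hcard, hx, -, rfl⟩
    exact (BorelTangent.tangentDim_le hI hB hcard hx).2.1 rfl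
  have h3 : TmaxEq 13 3 69 := by
    refine ⟨BorelTangent.mem_of_table BorelTangent.isBorelTable_of_m1_eq_three
      BorelTangent.separated_of_m1_eq_three (by decide +kernel) (by decide +kernel)
      (by decide +kernel) (by decide +kernel) (by decide +kernel), ?_⟩
    rintro _ ⟨I, hI, hB, hcard, hx, -, rfl⟩
    exact (BorelTangent.tangentDim_le hI hB hcard hx).2.2 rfl
  refine ⟨h2, h3, fun T1 T2 T3 hT1 hT2 hT3 => ?_⟩
  obtain rfl := hT2.unique h2
  obtain rfl := hT3.unique h3
  obtain ⟨I, hI, hB, hcard, hx, -, rfl⟩ := hT1.1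
  have := (BorelTangent.tangentDim_le hI hB hcard hx).1 rfl
  omega
end

section
/- T_{max,2}(14) = 64 and T_{max,3}(14) = 78; in particular, for l = 14 the function m1 ↦ T_{max,m1}(14) is strictly increasing on {1, 2, 3}. -/
open MvPolynomial

namespace HilbertTangent

/-- Polynomials in the three variables `x`, `y`, `z`. -/
abbrev Poly : Type := MvPolynomial (Fin 3) ℂ

section Coefficients

variable {I : Ideal Poly}

/-- The exponents of the monomials lying in `I`. -/
def exponents (I : Ideal Poly) : Set (Fin 3 →₀ ℕ) := {d | monomial d (1 : ℂ) ∈ I}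

theorem exponents_add {d : Fin 3 →₀ ℕ} (hd : d ∈ exponents I) (u : Fin 3 →₀ ℕ) :
    u + d ∈ exponents I := by
  have h := I.mul_mem_left (monomial u (1 : ℂ)) hd
  rwa [monomial_mul, one_mul] at h

theorem exponents_mono {d e : Fin 3 →₀ ℕ} (hd : d ∈ exponents I) (hde : d ≤ e) :
    e ∈ exponents I := by
  rw [← tsub_add_cancel_of_le hde]
  exact exponents_add hd _

theorem coeff_eq_zero_of_mem (hI : IsMonomialIdeal I) {f : Poly} (hf : f ∈ I)
    {d : Fin 3 →₀ ℕ} (hd : d ∉ exponents I) : coeff d f = 0 := by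
  by_contra h
  exact hd (hI f hf d (mem_support_iff.2 h))

theorem mem_of_coeff_eq_zero {f : Poly} (h : ∀ d ∉ exponents I, coeff d f = 0) : f ∈ I := by
  rw [f.as_sum]
  refine I.sum_mem fun d hd => ?_
  have hdI : d ∈ exponents I := by
    by_contra hn
    exact mem_support_iff.1 hd (h d hn)
  have := I.mul_mem_left (C (coeff d f)) hdI
  rwa [C_mul_monomial, mul_one] at this

/-- The coefficient of a standard monomial, as a functional on `R ⧸ I`. -/
noncomputable def quotCoeff (hI : IsMonomialIdeal I) (p : Fin 3 →₀ ℕ) (hp : p ∉ exponents I) :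
    (Poly ⧸ I) →ₗ[ℂ] ℂ :=
  ((I.restrictScalars ℂ).liftQ (lcoeff ℂ p) fun _ hf => coeff_eq_zero_of_mem hI hf hp) ∘ₗ
    (Submodule.Quotient.restrictScalarsEquiv ℂ I).symm.toLinearMap

@[simp]
theorem quotCoeff_mk (hI : IsMonomialIdeal I) {p : Fin 3 →₀ ℕ} (hp : p ∉ exponents I) (f : Poly) :
    quotCoeff hI p hp (Ideal.Quotient.mk I f) = coeff p f := rfl

theorem eq_zero_of_quotCoeff (hI : IsMonomialIdeal I) {q : Poly ⧸ I}
    (h : ∀ p hp, quotCoeff hI p hp q = 0) : q = 0 := by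
  obtain ⟨f, rfl⟩ := Ideal.Quotient.mk_surjective q
  exact Ideal.Quotient.eq_zero_iff_mem.2 (mem_of_coeff_eq_zero h)

theorem notMem_exponents_tsub {p : Fin 3 →₀ ℕ} (hp : p ∉ exponents I) (u : Fin 3 →₀ ℕ) :
    p - u ∉ exponents I := fun h => hp (exponents_mono h tsub_le_self)

theorem quotCoeff_monomial_smul (hI : IsMonomialIdeal I) {p : Fin 3 →₀ ℕ}
    (hp : p ∉ exponents I) (u : Fin 3 →₀ ℕ) (q : Poly ⧸ I) :
    quotCoeff hI p hp ((monomial u (1 : ℂ) : Poly) • q) =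
      if u ≤ p then quotCoeff hI (p - u) (notMem_exponents_tsub hp u) q else 0 := by
  obtain ⟨f, rfl⟩ := Ideal.Quotient.mk_surjective q
  have : (monomial u (1 : ℂ) : Poly) • Ideal.Quotient.mk I f =
      Ideal.Quotient.mk I (monomial u 1 * f) := rfl
  rw [this, quotCoeff_mk, coeff_monomial_mul']
  simp

/-- The classes of the standard monomials form a basis of `R ⧸ I`. -/
theorem finrank_quotient (hI : IsMonomialIdeal I) :
    Module.finrank ℂ (Poly ⧸ I) = Nat.card {d // d ∉ exponents I} := by
  let v : {d // d ∉ exponents I} → Poly ⧸ I := fun d => Ideal.Quotient.mk I (monomial d.1 1)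
  have hmon (d : Fin 3 →₀ ℕ) (a : ℂ) :
      Ideal.Quotient.mk I (monomial d a) = a • Ideal.Quotient.mk I (monomial d 1) := by
    have : (monomial d a : Poly) = a • monomial d 1 := by simp [smul_monomial]
    rw [this]; rfl
  have hli : LinearIndependent ℂ v := by
    rw [linearIndependent_iff']
    intro s c hs i hi
    have h := congrArg (quotCoeff hI i.1 i.2) hs
    simp only [map_sum, map_smul, map_zero, v, quotCoeff_mk, coeff_monomial, smul_eq_mul] at h
    rw [Finset.sum_eq_single i] at h
    · simpa using h
    · intro b _ hb
      rw [if_neg (fun hbi => hb (Subtype.ext hbi)), mul_zero]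
    · exact fun h => absurd hi h
  have hspan : ⊤ ≤ Submodule.span ℂ (Set.range v) := by
    rintro q -
    obtain ⟨f, rfl⟩ := Ideal.Quotient.mk_surjective q
    rw [f.as_sum, map_sum]
    refine Submodule.sum_mem _ fun d _ => ?_
    rw [hmon]
    refine Submodule.smul_mem _ _ ?_
    by_cases hd : d ∈ exponents I
    · rw [Ideal.Quotient.eq_zero_iff_mem.2 hd]
      exact Submodule.zero_mem _
    · exact Submodule.subset_span ⟨⟨d, hd⟩, rfl⟩
  exact Module.finrank_eq_nat_card_basis (Module.Basis.mk hli hspan)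

/-- The coefficient of `p` in the image of the monomial with exponent `m`, as a functional on
homomorphisms `I → R ⧸ I`. -/
noncomputable def homCoeff (hI : IsMonomialIdeal I) (m p : Fin 3 →₀ ℕ) (hm : m ∈ exponents I)
    (hp : p ∉ exponents I) : (I →ₗ[Poly] Poly ⧸ I) →ₗ[ℂ] ℂ where
  toFun φ := quotCoeff hI p hp (φ ⟨monomial m 1, hm⟩)
  map_add' _ _ := map_add _ _ _
  map_smul' c φ := (quotCoeff hI p hp).map_smul c (φ ⟨monomial m 1, hm⟩)

theorem homCoeff_add (hI : IsMonomialIdeal I) {m p u : Fin 3 →₀ ℕ} (hm : m ∈ exponents I)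
    (hum : u + m ∈ exponents I) (hp : p ∉ exponents I) (φ : I →ₗ[Poly] Poly ⧸ I) :
    homCoeff hI (u + m) p hum hp φ =
      if u ≤ p then homCoeff hI m (p - u) hm (notMem_exponents_tsub hp u) φ else 0 := by
  have h : (⟨monomial (u + m) 1, hum⟩ : I) =
      (monomial u (1 : ℂ) : Poly) • (⟨monomial m 1, hm⟩ : I) :=
    Subtype.ext (by simp [monomial_mul])
  change quotCoeff hI p hp (φ ⟨monomial (u + m) 1, hum⟩) = _
  rw [h, map_smul, quotCoeff_monomial_smul]
  rfl

theorem hom_ext_monomial {φ ψ : I →ₗ[Poly] Poly ⧸ I} (hI : IsMonomialIdeal I)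
    (h : ∀ m (hm : m ∈ exponents I), φ ⟨monomial m 1, hm⟩ = ψ ⟨monomial m 1, hm⟩) : φ = ψ := by
  ext ⟨f, hf⟩
  have key : (⟨f, hf⟩ : I) = ∑ d ∈ f.support.attach,
      (C (coeff d.1 f) : Poly) • (⟨monomial d.1 1, hI f hf d.1 d.2⟩ : I) := by
    apply Subtype.ext
    simp only [AddSubmonoidClass.coe_finsetSum, Submodule.coe_smul, smul_eq_mul, C_mul_monomial,
      mul_one]
    rw [Finset.sum_attach f.support (fun d => monomial d (coeff d f))]
    exact f.as_sum
  rw [key]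
  simp only [map_sum, map_smul]
  exact Finset.sum_congr rfl fun d _ => congrArg (C (coeff d.1 f) • ·) (h d.1 (hI f hf d.1 d.2))

theorem hom_eq_zero (hI : IsMonomialIdeal I) {φ : I →ₗ[Poly] Poly ⧸ I}
    (h : ∀ m p hm hp, homCoeff hI m p hm hp φ = 0) : φ = 0 :=
  hom_ext_monomial hI fun m hm => eq_zero_of_quotCoeff hI fun p hp => h m p hm hp

theorem homCoeff_link (hI : IsMonomialIdeal I) {g g' n : Fin 3 →₀ ℕ} (hg : g ∈ exponents I)
    (hg' : g' ∈ exponents I) (hn : n ∉ exponents I) (hl : n + (g' - g) ∉ exponents I)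
    (φ : I →ₗ[Poly] Poly ⧸ I) :
    (¬ g ≤ n + g' → homCoeff hI g n hg hn φ = 0) ∧
    (∀ h : n + g' - g ∉ exponents I, g ≤ n + g' →
      homCoeff hI g n hg hn φ = homCoeff hI g' (n + g' - g) hg' h φ) := by
  have key : homCoeff hI g n hg hn φ =
      if g - g' ≤ n + (g' - g) then
        homCoeff hI g' (n + (g' - g) - (g - g')) hg' (notMem_exponents_tsub hl _) φ else 0 := by
    have h1 := homCoeff_add hI hg (exponents_add hg (g' - g)) hl φ
    have h2 := homCoeff_add hI hg' (exponents_add hg' (g - g')) hl φ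
    have e : g' - g + g = g - g' + g' := by ext i; simp; omega
    simp only [le_add_iff_nonneg_left, zero_le, if_true, add_tsub_cancel_right] at h1
    rw [← h1, ← h2]
    congr 1
    simp only [e]
  have e1 : g - g' ≤ n + (g' - g) ↔ g ≤ n + g' := by
    simp only [Finsupp.le_def, Finsupp.coe_add, Finsupp.coe_tsub, Pi.add_apply, Pi.sub_apply]
    exact forall_congr' fun i => by omega
  refine ⟨fun h => by rw [key, if_neg (mt e1.1 h)], fun hn' h => ?_⟩
  have e2 : n + (g' - g) - (g - g') = n + g' - g := by
    ext i
    have := Finsupp.le_def.1 h i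
    simp only [Finsupp.coe_add, Finsupp.coe_tsub, Pi.add_apply, Pi.sub_apply] at this ⊢
    omega
  rw [key, if_pos (e1.2 h)]
  simp only [e2]

theorem exists_hom (hI : IsMonomialIdeal I) (hfin : {d | d ∉ exponents I}.Finite)
    (D : (Fin 3 →₀ ℕ) → (Fin 3 →₀ ℕ) → ℂ)
    (hD : ∀ m ∈ exponents I, ∀ p ∉ exponents I, ∀ i : Fin 3, D (Finsupp.single i 1 + m) p =
      if Finsupp.single i 1 ≤ p then D m (p - Finsupp.single i 1) else 0) :
    ∃ φ : I →ₗ[Poly] Poly ⧸ I, ∀ m hm p hp, homCoeff hI m p hm hp φ = D m p := by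
  let ψ : Poly →ₗ[ℂ] Poly ⧸ I := (basisMonomials (Fin 3) ℂ).constr ℂ fun m =>
    ∑ p ∈ hfin.toFinset, D m p • Ideal.Quotient.mk I (monomial p 1)
  have hψ (m : Fin 3 →₀ ℕ) : ψ (monomial m 1) =
      ∑ p ∈ hfin.toFinset, D m p • Ideal.Quotient.mk I (monomial p 1) := by
    have := (basisMonomials (Fin 3) ℂ).constr_basis ℂ (fun m =>
      ∑ p ∈ hfin.toFinset, D m p • Ideal.Quotient.mk I (monomial p 1)) m
    rwa [coe_basisMonomials] at this
  have hcoeff (m p : Fin 3 →₀ ℕ) (hp : p ∉ exponents I) :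
      quotCoeff hI p hp (ψ (monomial m 1)) = D m p := by
    rw [hψ]
    simp only [map_sum, map_smul, quotCoeff_mk, coeff_monomial, smul_eq_mul]
    rw [Finset.sum_eq_single p]
    · simp
    · intro b _ hb
      rw [if_neg hb, mul_zero]
    · exact fun h => absurd (hfin.mem_toFinset.2 hp) h
  have hX (i : Fin 3) (m : Fin 3 →₀ ℕ) (hm : m ∈ exponents I) :
      ψ (X i * monomial m 1) = (X i : Poly) • ψ (monomial m 1) := by
    rw [← sub_eq_zero]
    refine eq_zero_of_quotCoeff hI fun p hp => ?_
    rw [map_sub, sub_eq_zero, X, quotCoeff_monomial_smul, monomial_mul, one_mul, hcoeff, hcoeff,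
      hD m hm p hp]
  have hXf (i : Fin 3) (f : Poly) (hf : f ∈ I) : ψ (X i * f) = (X i : Poly) • ψ f := by
    have hmon (d : Fin 3 →₀ ℕ) : (monomial d (coeff d f) : Poly) = coeff d f • monomial d 1 := by
      simp [smul_monomial]
    rw [f.as_sum, Finset.mul_sum, map_sum, map_sum, Finset.smul_sum]
    refine Finset.sum_congr rfl fun d hd => ?_
    rw [hmon, mul_smul_comm, map_smul, map_smul, hX i d (hI f hf d hd), smul_comm]
  have hmul (r f : Poly) (hf : f ∈ I) : ψ (r * f) = r • ψ f := by
    induction r using MvPolynomial.induction_on generalizing f with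
    | C a =>
      rw [C_mul', map_smul]
      exact (algebraMap_smul Poly a (ψ f)).symm
    | add p q hp hq => rw [add_mul, map_add, hp f hf, hq f hf, add_smul]
    | mul_X p i hp =>
      rw [mul_assoc, hp _ (I.mul_mem_left _ hf), hXf i f hf, smul_smul]
  refine ⟨{ toFun := fun f => ψ f.1
            map_add' := fun f g => map_add ψ f.1 g.1
            map_smul' := fun r f => hmul r f.1 f.2 }, fun m hm p hp => hcoeff m p hp⟩

/-- A labelling of pairs (exponent of `I`, standard exponent) compatible with multiplication by the
variables, in which `1, …, K` all occur, gives `K` independent homomorphisms. -/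
theorem le_tangentDim_of_label (hI : IsMonomialIdeal I) (hfin : {d | d ∉ exponents I}.Finite)
    [Module.Finite ℂ (I →ₗ[Poly] Poly ⧸ I)] (ℓ : (Fin 3 →₀ ℕ) → (Fin 3 →₀ ℕ) → ℕ)
    (hℓ : ∀ m ∈ exponents I, ∀ p ∉ exponents I, ∀ i : Fin 3, ℓ (Finsupp.single i 1 + m) p =
      if Finsupp.single i 1 ≤ p then ℓ m (p - Finsupp.single i 1) else 0) (K : ℕ)
    (hK : ∀ k < K, ∃ m ∈ exponents I, ∃ p ∉ exponents I, ℓ m p = k + 1) :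
    K ≤ tangentDim I := by
  have hex (k : Fin K) : ∃ φ : I →ₗ[Poly] Poly ⧸ I, ∀ m hm p hp,
      homCoeff hI m p hm hp φ = if ℓ m p = k.1 + 1 then 1 else 0 := by
    refine exists_hom hI hfin (fun m p => if ℓ m p = k.1 + 1 then 1 else 0)
      fun m hm p hp i => ?_
    rw [hℓ m hm p hp i]
    split_ifs <;> simp_all
  choose φ hφ using hex
  choose m hm p hp hmp using hK
  have hli : LinearIndependent ℂ φ := by
    rw [linearIndependent_iff']
    intro s c hs i hi
    have h := congrArg (homCoeff hI (m i i.2) (p i i.2) (hm i i.2) (hp i i.2)) hs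
    simp only [map_sum, map_smul, map_zero, hφ, hmp, smul_eq_mul] at h
    rw [Finset.sum_eq_single i] at h
    · simpa using h
    · intro b _ hb
      rw [if_neg (fun hbi => hb (Fin.ext (by omega))), mul_zero]
    · exact fun h => absurd hi h
  simpa [tangentDim] using hli.fintype_card_le_finrank

end Coefficients
section Certificates

/-- Exponent vectors as triples. -/
abbrev Pt := ℕ × ℕ × ℕ

/-- The heights of the standard monomials over `x ^ a * y ^ b`, supported in `a < 3`, `b < 4`. -/
def ht (a₀ a₁ a₂ a₃ b₀ b₁ b₂ c₀ c₁ : ℕ) (a b : ℕ) : ℕ :=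
  ([[a₀, a₁, a₂, a₃], [b₀, b₁, b₂], [c₀, c₁]].getD a []).getD b 0

/-- Whether an exponent lies below the graph of `h`. -/
def below (h : ℕ → ℕ → ℕ) (t : Pt) : Bool := Nat.blt t.2.2 (h t.1 t.2.1)

/-- Componentwise comparison. -/
def leB (s t : Pt) : Bool := Nat.ble s.1 t.1 && (Nat.ble s.2.1 t.2.1 && Nat.ble s.2.2 t.2.2)

/-- Exponents of minimal generators of the ideal of monomials not below `h`. -/
def gens (h : ℕ → ℕ → ℕ) : List Pt :=
  (List.range 4).flatMap fun a => (List.range 5).filterMap fun b =>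
    if (Nat.ble a 0 || Nat.blt (h a b) (h (a - 1) b)) &&
        (Nat.ble b 0 || Nat.blt (h a b) (h a (b - 1))) then some (a, b, h a b) else none

/-- The exponents below `h`. -/
def stds (h : ℕ → ℕ → ℕ) : List Pt :=
  (List.range 3).flatMap fun a => (List.range 4).flatMap fun b =>
    (List.range (h a b)).map fun c => (a, b, c)

/-- Whether the Taylor syzygy of two generators constrains the coefficient of `n` in the image of
the first. -/
def linked (st : Pt → Bool) (g g' n : Pt) : Bool := st (n + (g' - g))

/-- Whether a chain of at most `k` syzygies forces the coefficient of `n` in the image of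
`g` to vanish. -/
def zeroB (st : Pt → Bool) (G : List Pt) : ℕ → Pt → Pt → Bool
  | 0, _, _ => false
  | k + 1, g, n => G.any fun g' => linked st g g' n &&
      (!leB g (n + g') || zeroB st G k g' (n + g' - g))

/-- An enumeration of the generators. -/
def rk (t : Pt) : ℕ := 100 * t.1 + 10 * t.2.1 + t.2.2

/-- Whether the coefficient of `n` in the image of `g` is recognised as zero or as determined by a
generator of smaller rank. -/
def dep (st : Pt → Bool) (G : List Pt) (k : ℕ) (g n : Pt) : Bool :=
  G.any fun g' => linked st g g' n &&
    (!leB g (n + g') || (Nat.blt (rk g') (rk g) || zeroB st G k g' (n + g' - g)))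

/-- The coefficients not recognised as determined by others. -/
def free (st : Pt → Bool) (G N : List Pt) (k : ℕ) : List (Pt × Pt) :=
  G.flatMap fun g => (N.filter fun n => !dep st G k g n).map fun n => (g, n)

/-- Whether `gens h` generates. -/
def gensOK (h : ℕ → ℕ → ℕ) : Bool :=
  (List.range 4).all fun a => (List.range 5).all fun b =>
    (gens h).any fun g => leB g (a, b, h a b)

/-- Whether the tangent space at the ideal of `h` is recognised to have dimension at most `B`. -/
def boundOK (h : ℕ → ℕ → ℕ) (B : ℕ) : Bool :=
  gensOK h && [0, 1, 2].any fun k => Nat.ble (free (below h) (gens h) (stds h) k).length B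

/-- The tangent space bounds `63`, `64`, `78` over all Borel-fixed height functions of volume
`14`. -/
def boundsOK : Bool :=
  (List.range 7).all fun a₁ => (List.range (max a₁ 1)).all fun a₂ =>
  (List.range (max a₂ 1)).all fun a₃ => (List.range (a₁ + 1)).all fun b₀ =>
  (List.range (min a₂ (b₀ - 1) + 1)).all fun b₁ =>
  (List.range (min a₃ (b₁ - 1) + 1)).all fun b₂ =>
  (List.range (b₁ + 1)).all fun c₀ => (List.range (min b₂ (c₀ - 1) + 1)).all fun c₁ =>
    let a₀ := 14 - (a₁ + a₂ + a₃ + b₀ + b₁ + b₂ + c₀ + c₁)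
    Nat.ble a₀ a₁ || boundOK (ht a₀ a₁ a₂ a₃ b₀ b₁ b₂ c₀ c₁)
      (if b₀ = 0 then 63 else if c₀ = 0 then 64 else 78)

theorem boundsOK_eq_true : boundsOK = true := by decide +kernel

end Certificates

section Exponents

/-- The exponent vector of `x ^ a * y ^ b * z ^ c`. -/
noncomputable def expo (t : Pt) : Fin 3 →₀ ℕ :=
  Finsupp.equivFunOnFinite.symm ![t.1, t.2.1, t.2.2]

/-- The coordinates of an exponent vector. -/
def coords (d : Fin 3 →₀ ℕ) : Pt := (d 0, d 1, d 2)

@[simp] theorem coords_expo (t : Pt) : coords (expo t) = t := by simp [coords, expo]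

@[simp] theorem expo_coords (d : Fin 3 →₀ ℕ) : expo (coords d) = d := by
  ext i; fin_cases i <;> simp [coords, expo]

@[simp] theorem coords_add (d e : Fin 3 →₀ ℕ) : coords (d + e) = coords d + coords e := rfl

@[simp] theorem coords_tsub (d e : Fin 3 →₀ ℕ) : coords (d - e) = coords d - coords e := rfl

theorem expo_add (s t : Pt) : expo (s + t) = expo s + expo t := by
  rw [← expo_coords (expo s + expo t)]; simp

theorem expo_tsub (s t : Pt) : expo (s - t) = expo s - expo t := by
  rw [← expo_coords (expo s - expo t)]; simp

theorem expo_injective : Function.Injective expo :=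
  Function.LeftInverse.injective coords_expo

theorem leB_iff {s t : Pt} : leB s t = true ↔ s ≤ t := by
  simp [leB, Prod.le_def]

theorem coords_le {d e : Fin 3 →₀ ℕ} : coords d ≤ coords e ↔ d ≤ e := by
  simp [coords, Prod.le_def, Finsupp.le_def, Fin.forall_fin_succ]

theorem expo_le {s t : Pt} : expo s ≤ expo t ↔ s ≤ t := by
  rw [← coords_le]; simp

end Exponents

section Bounds

variable {I : Ideal Poly} {st : Pt → Bool} {G N : List Pt}

theorem add_tsub_le_add_tsub' (n g g' : Pt) : n + g' - g ≤ n + (g' - g) := by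
  simp only [Prod.le_def, Prod.fst_add, Prod.snd_add, Prod.fst_sub, Prod.snd_sub]
  omega

theorem std_of_le (hst : ∀ t, st t = true ↔ expo t ∉ exponents I) {s t : Pt} (h : s ≤ t)
    (ht : st t = true) : st s = true :=
  (hst s).2 fun hs => (hst t).1 ht (exponents_mono hs (expo_le.2 h))

theorem mem_of_std_false (hst : ∀ t, st t = true ↔ expo t ∉ exponents I) {t : Pt}
    (ht : st t = false) : expo t ∈ exponents I := by
  by_contra h
  simp [(hst t).2 h] at ht

theorem homCoeff_eq_zero_of_link (hI : IsMonomialIdeal I)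
    (hst : ∀ t, st t = true ↔ expo t ∉ exponents I) {φ : I →ₗ[Poly] Poly ⧸ I} {g g' n : Pt}
    (hg : expo g ∈ exponents I) (hg' : expo g' ∈ exponents I) (hn : expo n ∉ exponents I)
    (hl : linked st g g' n = true)
    (h : leB g (n + g') = true → ∀ hn' : expo (n + g' - g) ∉ exponents I,
      homCoeff hI (expo g') (expo (n + g' - g)) hg' hn' φ = 0) :
    homCoeff hI (expo g) (expo n) hg hn φ = 0 := by
  have hl' : expo n + (expo g' - expo g) ∉ exponents I := by
    rw [← expo_tsub, ← expo_add]; exact (hst _).1 hl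
  have key := homCoeff_link hI hg hg' hn hl' φ
  by_cases hle : g ≤ n + g'
  · have hn' : expo (n + g' - g) ∉ exponents I :=
      (hst _).1 (std_of_le hst (add_tsub_le_add_tsub' n g g') hl)
    have h0 := h (leB_iff.2 hle) hn'
    have e : expo (n + g' - g) = expo n + expo g' - expo g := by rw [expo_tsub, expo_add]
    rw [key.2 (e ▸ hn') (by rw [← expo_add]; exact expo_le.2 hle)]
    simpa only [e] using h0
  · exact key.1 (by rw [← expo_add]; exact mt expo_le.1 hle)

theorem homCoeff_eq_zero_of_zeroB (hI : IsMonomialIdeal I)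
    (hst : ∀ t, st t = true ↔ expo t ∉ exponents I) (hG : ∀ g ∈ G, st g = false)
    (φ : I →ₗ[Poly] Poly ⧸ I) (k : ℕ) {g n : Pt} (hz : zeroB st G k g n = true)
    (hg : expo g ∈ exponents I) (hn : expo n ∉ exponents I) :
    homCoeff hI (expo g) (expo n) hg hn φ = 0 := by
  induction k generalizing g n with
  | zero => simp [zeroB] at hz
  | succ k ih =>
    simp only [zeroB, List.any_eq_true, Bool.and_eq_true, Bool.or_eq_true] at hz
    obtain ⟨g', hg', hl, hz⟩ := hz
    refine homCoeff_eq_zero_of_link hI hst hg (mem_of_std_false hst (hG g' hg')) hn hl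
      fun hle hn' => ih (hz.resolve_left ?_) _ hn'
    simp [hle]

theorem homCoeff_eq_zero_of_free (hI : IsMonomialIdeal I)
    (hst : ∀ t, st t = true ↔ expo t ∉ exponents I) (hG : ∀ g ∈ G, st g = false)
    (hN : ∀ t, st t = true → t ∈ N) (φ : I →ₗ[Poly] Poly ⧸ I) (k : ℕ)
    (hφ : ∀ q ∈ free st G N k, ∀ h₁ h₂, homCoeff hI (expo q.1) (expo q.2) h₁ h₂ φ = 0)
    {g : Pt} (hgG : g ∈ G) {n : Pt} (hg : expo g ∈ exponents I) (hn : expo n ∉ exponents I) :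
    homCoeff hI (expo g) (expo n) hg hn φ = 0 := by
  induction hr : rk g using Nat.strong_induction_on generalizing g n with
  | _ r ih =>
    by_cases hd : dep st G k g n = true
    · simp only [dep, List.any_eq_true, Bool.and_eq_true, Bool.or_eq_true] at hd
      obtain ⟨g', hg', hl, hd⟩ := hd
      refine homCoeff_eq_zero_of_link hI hst hg (mem_of_std_false hst (hG g' hg')) hn hl
        fun hle hn' => ?_
      rcases hd.resolve_left (by simp [hle]) with h | h
      · exact ih (rk g') (by simpa [Nat.blt_eq, hr] using h) hg' _ hn' rfl
      · exact homCoeff_eq_zero_of_zeroB hI hst hG φ k h _ hn'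
    · refine hφ (g, n) ?_ hg hn
      simp only [free, List.mem_flatMap, List.mem_map, List.mem_filter]
      exact ⟨g, hgG, n, ⟨hN n ((hst n).2 hn), by simpa using hd⟩, rfl⟩

theorem mem_of_mem_free {k : ℕ} {q : Pt × Pt} (hq : q ∈ free st G N k) : q.1 ∈ G ∧ q.2 ∈ N := by
  simp only [free, List.mem_flatMap, List.mem_map, List.mem_filter] at hq
  obtain ⟨g, hg, n, ⟨hn, -⟩, rfl⟩ := hq
  exact ⟨hg, hn⟩

theorem finite_and_tangentDim_le (hI : IsMonomialIdeal I)
    (hst : ∀ t, st t = true ↔ expo t ∉ exponents I) (hG : ∀ g ∈ G, st g = false)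
    (hgen : ∀ t, st t = false → ∃ g ∈ G, g ≤ t) (hN : ∀ t ∈ N, st t = true)
    (hN' : ∀ t, st t = true → t ∈ N) (k : ℕ) :
    Module.Finite ℂ (I →ₗ[Poly] Poly ⧸ I) ∧ tangentDim I ≤ (free st G N k).length := by
  let F : (I →ₗ[Poly] Poly ⧸ I) →ₗ[ℂ] (Fin (free st G N k).length → ℂ) :=
    LinearMap.pi fun j => homCoeff hI (expo ((free st G N k).get j).1)
      (expo ((free st G N k).get j).2)
      (mem_of_std_false hst (hG _ (mem_of_mem_free (List.get_mem _ j)).1))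
      ((hst _).1 (hN _ (mem_of_mem_free (List.get_mem _ j)).2))
  have hF : Function.Injective F := by
    rw [← LinearMap.ker_eq_bot, LinearMap.ker_eq_bot']
    intro φ hφ
    have h0 : ∀ q ∈ free st G N k, ∀ h₁ h₂,
        homCoeff hI (expo q.1) (expo q.2) h₁ h₂ φ = 0 := by
      intro q hq h₁ h₂
      obtain ⟨j, rfl⟩ := List.get_of_mem hq
      exact congrFun hφ j
    refine hom_eq_zero hI fun m p hm hp => ?_
    obtain ⟨g, hg, hgm⟩ := hgen (coords m) (by
      by_contra h
      exact (hst (coords m)).1 (by simpa using h) (by simpa using hm))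
    have hgm' : expo g ≤ m := by simpa using expo_le.2 hgm
    have hgI := mem_of_std_false hst (hG g hg)
    have hadd := homCoeff_add hI hgI (exponents_add hgI (m - expo g)) hp φ
    simp only [tsub_add_cancel_of_le hgm'] at hadd
    rw [hadd]
    split_ifs
    · have hq := notMem_exponents_tsub hp (m - expo g)
      have := homCoeff_eq_zero_of_free hI hst hG hN' φ k h0 hg (n := coords (p - (m - expo g)))
        hgI (by rwa [expo_coords])
      simpa only [expo_coords] using this
    · rfl
  refine ⟨Module.Finite.of_injective F hF, ?_⟩
  simpa [tangentDim] using LinearMap.finrank_le_finrank_of_injective hF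

/-- The label at `p` of the multiple `x ^ u * x ^ g` of a generator, given labels at `x ^ g`. -/
def shiftLabel (lab : Pt → Pt → ℕ) (g u p : Pt) : ℕ := if leB u p then lab g (p - u) else 0

/-- The labels on generators agree along all Taylor syzygies. -/
def consistent (lab : Pt → Pt → ℕ) (G N : List Pt) : Bool :=
  G.all fun g => G.all fun g' => N.all fun p =>
    Nat.beq (shiftLabel lab g (g' - g) p) (shiftLabel lab g' (g - g') p)

theorem shiftLabel_add (lab : Pt → Pt → ℕ) (g w u p : Pt) :
    shiftLabel lab g (w + u) p = if w ≤ p then shiftLabel lab g u (p - w) else 0 := by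
  have h : w + u ≤ p ↔ w ≤ p ∧ u ≤ p - w := by
    simp only [Prod.le_def, Prod.fst_add, Prod.snd_add, Prod.fst_sub, Prod.snd_sub]
    omega
  by_cases hw : w ≤ p <;> simp [shiftLabel, leB_iff, h, hw, tsub_tsub]

theorem shiftLabel_eq (hst : ∀ t, st t = true ↔ expo t ∉ exponents I)
    (hN' : ∀ t, st t = true → t ∈ N) {lab : Pt → Pt → ℕ} (hlab : consistent lab G N = true)
    {g g' m p : Pt} (hg : g ∈ G) (hg' : g' ∈ G) (hgm : g ≤ m) (hgm' : g' ≤ m)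
    (hp : st p = true) : shiftLabel lab g (m - g) p = shiftLabel lab g' (m - g') p := by
  have e : m - g = m - (g ⊔ g') + (g' - g) := by
    ext <;> simp only [Prod.fst_add, Prod.snd_add, Prod.fst_sub, Prod.snd_sub, Prod.fst_sup,
      Prod.snd_sup, Prod.le_def] at * <;> omega
  have e' : m - g' = m - (g ⊔ g') + (g - g') := by
    ext <;> simp only [Prod.fst_add, Prod.snd_add, Prod.fst_sub, Prod.snd_sub, Prod.fst_sup,
      Prod.snd_sup, Prod.le_def] at * <;> omega
  rw [e, e', shiftLabel_add, shiftLabel_add]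
  simp only [consistent, List.all_eq_true] at hlab
  split_ifs
  · exact Nat.eq_of_beq_eq_true (hlab g hg g' hg' _ (hN' _ (std_of_le hst tsub_le_self hp)))
  · rfl

theorem le_tangentDim (hI : IsMonomialIdeal I)
    (hst : ∀ t, st t = true ↔ expo t ∉ exponents I) (hG : ∀ g ∈ G, st g = false)
    (hgen : ∀ t, st t = false → ∃ g ∈ G, g ≤ t) (hN : ∀ t ∈ N, st t = true)
    (hN' : ∀ t, st t = true → t ∈ N) {lab : Pt → Pt → ℕ} (hlab : consistent lab G N = true)
    {K : ℕ} (hK : ∀ k < K, ∃ g ∈ G, ∃ n ∈ N, lab g n = k + 1) : K ≤ tangentDim I := by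
  have hfin : {d | d ∉ exponents I}.Finite := by
    refine ((List.finite_toSet N).image expo).subset fun d hd => ?_
    exact ⟨coords d, hN' _ ((hst _).2 (by simpa using hd)), expo_coords d⟩
  have hgen' (m : Pt) : ∃ g, st m = false → g ∈ G ∧ g ≤ m := by
    by_cases h : st m = false
    · obtain ⟨g, hg⟩ := hgen m h
      exact ⟨g, fun _ => hg⟩
    · exact ⟨0, fun h' => absurd h' h⟩
  choose γ hγ using hgen'
  have hstd {d : Fin 3 →₀ ℕ} (hd : d ∉ exponents I) : st (coords d) = true :=
    (hst _).2 (by simpa using hd)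
  have hnstd {d : Fin 3 →₀ ℕ} (hd : d ∈ exponents I) : st (coords d) = false := by
    by_contra h
    exact (hst (coords d)).1 (by simpa using h) (by simpa using hd)
  have := (finite_and_tangentDim_le hI hst hG hgen hN hN' 0).1
  refine le_tangentDim_of_label hI hfin
    (fun m p => shiftLabel lab (γ (coords m)) (coords m - γ (coords m)) (coords p)) ?_ K ?_
  · intro m hm p hp i
    have hγm := hγ _ (hnstd hm)
    have hγm' := hγ _ (hnstd (exponents_add hm (Finsupp.single i 1)))
    have hle : γ (coords m) ≤ coords (Finsupp.single i 1 + m) :=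
      hγm.2.trans (by rw [coords_add]; exact le_add_self)
    rw [shiftLabel_eq hst hN' hlab hγm'.1 hγm.1 hγm'.2 hle (hstd hp), coords_add,
      add_tsub_assoc_of_le hγm.2, shiftLabel_add, coords_tsub]
    simp only [coords_le]
  · intro k hk
    obtain ⟨g, hg, n, hn, hgn⟩ := hK k hk
    refine ⟨expo g, mem_of_std_false hst (hG g hg), expo n, (hst n).1 (hN n hn), ?_⟩
    have hγg := hγ g (hG g hg)
    rw [coords_expo, coords_expo, shiftLabel_eq hst hN' hlab hγg.1 hg hγg.2 le_rfl (hN n hn)]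
    simpa [shiftLabel, leB_iff] using hgn

end Bounds

section Heights

variable {I : Ideal Poly} {h : ℕ → ℕ → ℕ}

/-- The height function `h` vanishes outside the rectangle `a < 3`, `b < 4`. -/
def Supported (h : ℕ → ℕ → ℕ) : Prop := ∀ a b, 3 ≤ a ∨ 4 ≤ b → h a b = 0

theorem below_iff {t : Pt} : below h t = true ↔ t.2.2 < h t.1 t.2.1 := by
  rw [below, Nat.blt_eq]

theorem below_eq_false_iff {t : Pt} : below h t = false ↔ h t.1 t.2.1 ≤ t.2.2 := by
  rw [← Bool.not_eq_true, below_iff, not_lt]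

theorem supported_ht (a₀ a₁ a₂ a₃ b₀ b₁ b₂ c₀ c₁ : ℕ) :
    Supported (ht a₀ a₁ a₂ a₃ b₀ b₁ b₂ c₀ c₁) := by
  intro a b hab
  match a, b with
  | 0, b + 4 | 1, b + 4 | 2, b + 4 | a + 3, b => simp [ht]
  | 0, 0 | 0, 1 | 0, 2 | 0, 3 | 1, 0 | 1, 1 | 1, 2 | 1, 3 | 2, 0 | 2, 1 | 2, 2 | 2, 3 => omega

theorem eq_ht (hs : Supported h) (h₁ : h 1 3 = 0) (h₂ : h 2 2 = 0) (h₃ : h 2 3 = 0) :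
    h = ht (h 0 0) (h 0 1) (h 0 2) (h 0 3) (h 1 0) (h 1 1) (h 1 2) (h 2 0) (h 2 1) := by
  funext a b
  by_cases hab : 3 ≤ a ∨ 4 ≤ b
  · rw [hs a b hab, supported_ht _ _ _ _ _ _ _ _ _ a b hab]
  · have ha : a < 3 := by omega
    have hb : b < 4 := by omega
    interval_cases a <;> interval_cases b <;> simp [ht, h₁, h₂, h₃]

theorem mem_stds (hs : Supported h) {t : Pt} : t ∈ stds h ↔ below h t = true := by
  obtain ⟨a, b, c⟩ := t
  simp only [stds, List.mem_flatMap, List.mem_range, List.mem_map, Prod.mk.injEq, below_iff]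
  constructor
  · rintro ⟨a, -, b, -, c, hc, rfl, rfl, rfl⟩
    exact hc
  · intro hc
    refine ⟨a, ?_, b, ?_, c, hc, rfl, rfl, rfl⟩
    all_goals
      by_contra hlt
      have := hs a b (by omega)
      omega

theorem below_of_mem_gens {g : Pt} (hg : g ∈ gens h) : below h g = false := by
  simp only [gens, List.mem_flatMap, List.mem_filterMap, Option.ite_none_right_eq_some,
    Option.some.injEq] at hg
  obtain ⟨a, -, b, -, -, rfl⟩ := hg
  exact below_eq_false_iff.2 le_rfl

theorem exists_gen_le (hs : Supported h) (hOK : gensOK h = true) {t : Pt}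
    (ht : below h t = false) : ∃ g ∈ gens h, g ≤ t := by
  obtain ⟨a, b, c⟩ := t
  simp only [gensOK, List.all_eq_true, List.any_eq_true, List.mem_range] at hOK
  obtain ⟨g, hg, hle⟩ := hOK (min a 3) (by omega) (min b 4) (by omega)
  refine ⟨g, hg, (leB_iff.1 hle).trans ?_⟩
  have e : h (min a 3) (min b 4) = h a b := by
    by_cases hab : 3 ≤ a ∨ 4 ≤ b
    · rw [hs a b hab, hs _ _ (by omega)]
    · rw [min_eq_left (by omega), min_eq_left (by omega)]
  rw [e]
  exact ⟨min_le_left _ _, min_le_left _ _, below_eq_false_iff.1 ht⟩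

theorem tangentDim_le_of_boundOK (hI : IsMonomialIdeal I) (hs : Supported h)
    (hh : ∀ t, below h t = true ↔ expo t ∉ exponents I) {B : ℕ} (hB : boundOK h B = true) :
    tangentDim I ≤ B := by
  simp only [boundOK, Bool.and_eq_true, List.any_eq_true] at hB
  obtain ⟨hOK, k, -, hk⟩ := hB
  exact (finite_and_tangentDim_le hI hh (fun g hg => below_of_mem_gens hg)
    (fun t ht => exists_gen_le hs hOK ht) (fun t ht => (mem_stds hs).1 ht)
    (fun t ht => (mem_stds hs).2 ht) k).2.trans (Nat.le_of_ble_eq_true hk)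

theorem card_standard (hh : ∀ t, below h t = true ↔ expo t ∉ exponents I) (P : Finset (ℕ × ℕ))
    (hP : ∀ a b, h a b ≠ 0 → (a, b) ∈ P) :
    Nat.card {d // d ∉ exponents I} = ∑ q ∈ P, h q.1 q.2 := by
  let S : Finset (Fin 3 →₀ ℕ) := (P.sigma fun q => Finset.range (h q.1 q.2)).image
    fun s => expo (s.1.1, s.1.2, s.2)
  have hS : ∀ d, d ∈ S ↔ d ∉ exponents I := by
    intro d
    simp only [S, Finset.mem_image, Finset.mem_sigma, Finset.mem_range]
    constructor
    · rintro ⟨⟨⟨a, b⟩, c⟩, ⟨-, hc⟩, rfl⟩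
      exact (hh _).1 (below_iff.2 hc)
    · intro hd
      have hc := below_iff.1 ((hh (coords d)).2 (by rwa [expo_coords]))
      exact ⟨⟨((coords d).1, (coords d).2.1), (coords d).2.2⟩,
        ⟨hP _ _ (by omega), hc⟩, expo_coords d⟩
  rw [Nat.subtype_card S hS, Finset.card_image_of_injective, Finset.card_sigma]
  · simp
  · rintro ⟨⟨a, b⟩, c⟩ ⟨⟨a', b'⟩, c'⟩ he
    have := expo_injective he
    simp only [Prod.mk.injEq] at this
    obtain ⟨rfl, rfl, rfl⟩ := this
    rfl

theorem exists_heights (hfin : Finite {d // d ∉ exponents I}) :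
    ∃ h : ℕ → ℕ → ℕ, ∀ t, below h t = true ↔ expo t ∉ exponents I := by
  classical
  have hex (a b : ℕ) : ∃ c, expo (a, b, c) ∈ exponents I := by
    by_contra! hc
    refine not_injective_infinite_finite
      (fun c : ℕ => (⟨expo (a, b, c), hc c⟩ : {d // d ∉ exponents I})) fun c c' he => ?_
    simpa using expo_injective (congrArg Subtype.val he)
  refine ⟨fun a b => Nat.find (hex a b), fun ⟨a, b, c⟩ => ?_⟩
  rw [below_iff]
  refine ⟨fun hc => Nat.find_min (hex a b) hc, fun hc => ?_⟩
  by_contra hlt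
  exact hc (exponents_mono (Nat.find_spec (hex a b)) (expo_le.2 ⟨le_rfl, le_rfl, not_lt.1 hlt⟩))

theorem expo_eq (a b c : ℕ) : expo (a, b, c) =
    Finsupp.single 0 a + Finsupp.single 1 b + Finsupp.single 2 c := by
  ext i; fin_cases i <;> simp [expo]

theorem borel_y_of_z (hB : IsBorelFixed I) {a b c : ℕ}
    (h : expo (a, b, c + 1) ∈ exponents I) : expo (a, b + 1, c) ∈ exponents I := by
  have e : expo (a, b, c + 1) + Finsupp.single 1 1 - Finsupp.single 2 1 = expo (a, b + 1, c) := by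
    ext i; fin_cases i <;> simp [expo, Matrix.vecHead, Matrix.vecTail]
  exact e ▸ hB _ h 1 2 (by decide) (by simp [expo])

theorem borel_x_of_y (hB : IsBorelFixed I) {a b c : ℕ}
    (h : expo (a, b + 1, c) ∈ exponents I) : expo (a + 1, b, c) ∈ exponents I := by
  have e : expo (a, b + 1, c) + Finsupp.single 0 1 - Finsupp.single 1 1 = expo (a + 1, b, c) := by
    ext i; fin_cases i <;> simp [expo, Matrix.vecHead, Matrix.vecTail]
  exact e ▸ hB _ h 0 1 (by decide) (by simp [expo])

theorem mem_exponents_iff (hh : ∀ t, below h t = true ↔ expo t ∉ exponents I) {t : Pt} :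
    expo t ∈ exponents I ↔ h t.1 t.2.1 ≤ t.2.2 := by
  rw [← not_iff_not, ← hh, below_iff, not_le]

theorem heights_borel (hB : IsBorelFixed I)
    (hh : ∀ t, below h t = true ↔ expo t ∉ exponents I) (a b : ℕ) :
    h a (b + 1) ≤ h a b - 1 ∧ h (a + 1) b ≤ h a (b + 1) := by
  constructor
  · have h0 : expo (a, b, h a b) ∈ exponents I := (mem_exponents_iff hh).2 le_rfl
    rcases hz : h a b with _ | c
    · have hle : (a, b, h a b) ≤ (a, b + 1, h a b) := ⟨le_rfl, Nat.le_succ b, le_rfl⟩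
      have := (mem_exponents_iff hh).1 (exponents_mono h0 (expo_le.2 hle))
      simpa [hz] using this
    · rw [hz] at h0
      exact (mem_exponents_iff hh).1 (borel_y_of_z hB h0)
  · exact (mem_exponents_iff hh).1 (borel_x_of_y hB ((mem_exponents_iff hh).2 le_rfl))

theorem X_pow_mem_iff (hh : ∀ t, below h t = true ↔ expo t ∉ exponents I) (m : ℕ) :
    (X 0 : Poly) ^ m ∈ I ↔ h m 0 = 0 := by
  have e : (X 0 : Poly) ^ m = monomial (expo (m, 0, 0)) 1 := by
    rw [X_pow_eq_monomial, expo_eq]; simp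
  rw [e]
  exact (mem_exponents_iff hh).trans Nat.le_zero

theorem boundOK_of_borel (hb : ∀ a b, h a (b + 1) ≤ h a b - 1 ∧ h (a + 1) b ≤ h a (b + 1))
    (h₃ : h 3 0 = 0) {P : Finset (ℕ × ℕ)} (hP : ∀ a b, h a b ≠ 0 → (a, b) ∈ P)
    (hsum : ∑ q ∈ P, h q.1 q.2 = 14) :
    Supported h ∧ boundOK h (if h 1 0 = 0 then 63 else if h 2 0 = 0 then 64 else 78) = true := by
  have hsub (Q : Finset (ℕ × ℕ)) : ∑ q ∈ Q, h q.1 q.2 ≤ 14 := by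
    rw [← hsum]
    refine Finset.sum_le_sum_of_ne_zero fun q _ hq => hP _ _ hq
  have hb0 (a b : ℕ) : h a b ≤ h a 0 := by
    induction b with
    | zero => exact le_rfl
    | succ b ih => have := (hb a b).1; omega
  have hrow3 (a : ℕ) : h (3 + a) 0 = 0 := by
    induction a with
    | zero => exact h₃
    | succ a ih =>
      have h1 : h (3 + (a + 1)) 0 ≤ h (3 + a) 1 := (hb (3 + a) 0).2
      have h2 := hb0 (3 + a) 1
      omega
  have h04 : h 0 4 = 0 := by
    have h1 := hsub ({0} ×ˢ Finset.range 5)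
    simp only [Finset.singleton_product, Finset.sum_map, Finset.sum_range_succ,
      Finset.sum_range_zero, Function.Embedding.coeFn_mk] at h1
    have h2 : h 0 1 ≤ h 0 0 - 1 := (hb 0 0).1
    have h3 : h 0 2 ≤ h 0 1 - 1 := (hb 0 1).1
    have h4 : h 0 3 ≤ h 0 2 - 1 := (hb 0 2).1
    have h5 : h 0 4 ≤ h 0 3 - 1 := (hb 0 3).1
    omega
  have hcol4 (b : ℕ) : h 0 (4 + b) = 0 := by
    induction b with
    | zero => exact h04
    | succ b ih =>
      have h1 : h 0 (4 + (b + 1)) ≤ h 0 (4 + b) - 1 := (hb 0 (4 + b)).1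
      omega
  have hcol (a b : ℕ) : h a b ≤ h 0 b := by
    induction a generalizing b with
    | zero => exact le_rfl
    | succ a ih =>
      have := (hb a b).2; have := (hb a b).1; have := ih b
      omega
  have hs : Supported h := by
    rintro a b (ha | hb')
    · obtain ⟨a, rfl⟩ := Nat.exists_eq_add_of_le ha
      have := hb0 (3 + a) b; have := hrow3 a
      omega
    · obtain ⟨b, rfl⟩ := Nat.exists_eq_add_of_le hb'
      have := hcol a (4 + b); have := hcol4 b
      omega
  refine ⟨hs, ?_⟩
  have htot : ∑ q ∈ Finset.range 3 ×ˢ Finset.range 4, h q.1 q.2 = 14 := by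
    refine le_antisymm (hsub _) ?_
    rw [← hsum]
    refine Finset.sum_le_sum_of_ne_zero fun q _ hq => ?_
    by_contra hn
    simp only [Finset.mem_product, Finset.mem_range] at hn
    exact hq (hs _ _ (by omega))
  simp only [Finset.sum_product, Finset.sum_range_succ, Finset.sum_range_zero] at htot
  have h00 := hb 0 0; have h01 := hb 0 1; have h02 := hb 0 2; have h03 := hb 0 3
  have h10 := hb 1 0; have h11 := hb 1 1; have h12 := hb 1 2; have h13 := hb 1 3
  have h20 := hb 2 0; have h21 := hb 2 1; have h22 := hb 2 2
  simp only [Nat.reduceAdd] at h00 h01 h02 h03 h10 h11 h12 h13 h20 h21 h22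
  have z13 : h 1 3 = 0 := by omega
  have z22 : h 2 2 = 0 := by omega
  have z23 : h 2 3 = 0 := by omega
  have key := boundsOK_eq_true
  simp only [boundsOK, List.all_eq_true, List.mem_range] at key
  have := key (h 0 1) (by omega) (h 0 2) (by omega) (h 0 3) (by omega) (h 1 0) (by omega)
    (h 1 1) (by omega) (h 1 2) (by omega) (h 2 0) (by omega) (h 2 1) (by omega)
  have e : 14 - (h 0 1 + h 0 2 + h 0 3 + h 1 0 + h 1 1 + h 1 2 + h 2 0 + h 2 1) = h 0 0 := by
    omega
  rw [e, ← eq_ht hs z13 z22 z23, Bool.or_eq_true] at this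
  refine this.resolve_left fun hle => ?_
  have := Nat.le_of_ble_eq_true hle
  omega

theorem tangentDim_le_of_borel (hI : IsMonomialIdeal I) (hB : IsBorelFixed I)
    (hcard : Module.finrank ℂ (Poly ⧸ I) = 14) (hx : (X 0 : Poly) ^ 3 ∈ I) :
    ((X 0 : Poly) ^ 1 ∈ I → tangentDim I ≤ 63) ∧
    ((X 0 : Poly) ^ 2 ∈ I → tangentDim I ≤ 64) ∧ tangentDim I ≤ 78 := by
  rw [finrank_quotient hI] at hcard
  obtain ⟨h, hh⟩ := exists_heights (I := I) (Nat.finite_of_card_ne_zero (by omega))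
  have hb := heights_borel hB hh
  rw [X_pow_mem_iff hh] at hx
  have hle (a b : ℕ) : h a b + a + b ≤ h 0 0 ∨ h a b = 0 := by
    induction a generalizing b with
    | zero =>
      induction b with
      | zero => simp
      | succ b ih => have := (hb 0 b).1; omega
    | succ a ih => have := (hb a b).2; have := ih (b + 1); omega
  let P := Finset.range (h 0 0) ×ˢ Finset.range (h 0 0)
  have hP : ∀ a b, h a b ≠ 0 → (a, b) ∈ P := by
    intro a b hab
    have := hle a b
    simp only [P, Finset.mem_product, Finset.mem_range]
    omega
  rw [card_standard hh P hP] at hcard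
  obtain ⟨hs, hOK⟩ := boundOK_of_borel hb hx hP hcard
  have hT := tangentDim_le_of_boundOK hI hs hh hOK
  rw [X_pow_mem_iff hh, X_pow_mem_iff hh]
  refine ⟨fun h1 => by simpa [h1] using hT, fun h2 => ?_, ?_⟩ <;> split_ifs at hT <;> omega

end Heights

section Examples

variable {h : ℕ → ℕ → ℕ}

/-- The monomial ideal whose standard monomials are those below `h`. -/
noncomputable def heightIdeal (h : ℕ → ℕ → ℕ) : Ideal Poly :=
  Ideal.span ((fun d => monomial d 1) '' {d | below h (coords d) = false})

/-- The height function `h` satisfies the exchange conditions of a Borel-fixed ideal. -/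
def BorelHeights (h : ℕ → ℕ → ℕ) : Prop :=
  ∀ a b, h a (b + 1) ≤ h a b - 1 ∧ h (a + 1) b ≤ h a (b + 1)

theorem borelHeights_of_supported (hs : Supported h)
    (hb : ∀ a < 3, ∀ b < 4, h a (b + 1) ≤ h a b - 1 ∧ h (a + 1) b ≤ h a (b + 1)) :
    BorelHeights h := by
  intro a b
  by_cases hab : 3 ≤ a ∨ 4 ≤ b
  · rw [hs a (b + 1) (by omega), hs (a + 1) b (by omega)]
    simp
  · exact hb a (by omega) b (by omega)

theorem heights_antitone (hb : BorelHeights h) {a b a' b' : ℕ} (ha : a ≤ a') (hb' : b ≤ b') :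
    h a' b' ≤ h a b := by
  have h1 : h a b' ≤ h a b :=
    antitone_nat_of_succ_le (f := fun b => h a b) (fun b => by have := (hb a b).1; omega) hb'
  have h2 : h a' b' ≤ h a b' :=
    antitone_nat_of_succ_le (f := fun a => h a b')
      (fun a => by have := (hb a b').1; have := (hb a b').2; omega) ha
  exact h2.trans h1

theorem mem_heightIdeal (hb : BorelHeights h) {f : Poly} :
    f ∈ heightIdeal h ↔ ∀ d ∈ f.support, below h (coords d) = false := by
  rw [heightIdeal, mem_ideal_span_monomial_image]
  refine forall₂_congr fun d _ => ⟨?_, fun hd => ⟨d, hd, le_rfl⟩⟩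
  rintro ⟨e, he, hed⟩
  rw [Set.mem_ofPred_eq, below_eq_false_iff] at he
  obtain ⟨h1, h2, h3⟩ := coords_le.2 hed
  exact below_eq_false_iff.2 ((heights_antitone hb h1 h2).trans (he.trans h3))

theorem mem_exponents_heightIdeal (hb : BorelHeights h) {d : Fin 3 →₀ ℕ} :
    d ∈ exponents (heightIdeal h) ↔ below h (coords d) = false := by
  rw [exponents, Set.mem_ofPred_eq, mem_heightIdeal hb, support_monomial, if_neg one_ne_zero]
  simp

theorem below_iff_heightIdeal (hb : BorelHeights h) (t : Pt) :
    below h t = true ↔ expo t ∉ exponents (heightIdeal h) := by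
  rw [mem_exponents_heightIdeal hb]; simp

theorem isMonomialIdeal_heightIdeal (hb : BorelHeights h) : IsMonomialIdeal (heightIdeal h) :=
  fun _ hf d hd => (mem_exponents_heightIdeal hb).2 ((mem_heightIdeal hb).1 hf d hd)

theorem isBorelFixed_heightIdeal (hb : BorelHeights h) : IsBorelFixed (heightIdeal h) := by
  intro d hd i j hij hj
  have hd' := (mem_exponents_heightIdeal hb).1 hd
  refine (mem_exponents_heightIdeal hb).2 ?_
  rw [below_eq_false_iff] at hd' ⊢
  have hcases : (i = 0 ∧ j = 1) ∨ (i = 0 ∧ j = 2) ∨ (i = 1 ∧ j = 2) := by omega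
  rcases hcases with ⟨rfl, rfl⟩ | ⟨rfl, rfl⟩ | ⟨rfl, rfl⟩
  · have := (hb (d 0) (d 1 - 1)).2
    simp only [coords] at hd' ⊢
    simp
    rw [Nat.sub_add_cancel hj] at this
    omega
  · have h1 := (hb (d 0) (d 1)).2
    have h2 := (hb (d 0) (d 1)).1
    simp only [coords] at hd' ⊢
    simp
    omega
  · have := (hb (d 0) (d 1)).1
    simp only [coords] at hd' ⊢
    simp
    omega

/-- The label of a pair: its position among the free pairs, or `0`. -/
def position (L : List (Pt × Pt)) (g n : Pt) : ℕ :=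
  if (g, n) ∈ L then L.idxOf (g, n) + 1 else 0

theorem le_tangentDim_heightIdeal (hs : Supported h) (hb : BorelHeights h)
    (hOK : gensOK h = true) (k : ℕ)
    (hnd : (free (below h) (gens h) (stds h) k).Nodup)
    (hc : consistent (position (free (below h) (gens h) (stds h) k)) (gens h) (stds h) = true) :
    (free (below h) (gens h) (stds h) k).length ≤ tangentDim (heightIdeal h) := by
  refine le_tangentDim (isMonomialIdeal_heightIdeal hb) (below_iff_heightIdeal hb)
    (fun g hg => below_of_mem_gens hg) (fun t ht => exists_gen_le hs hOK ht)
    (fun t ht => (mem_stds hs).1 ht) (fun t ht => (mem_stds hs).2 ht) hc fun j hj => ?_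
  have hmem := List.getElem_mem hj
  obtain ⟨hg, hn⟩ := mem_of_mem_free hmem
  refine ⟨_, hg, _, hn, ?_⟩
  rw [position, Prod.mk.eta, if_pos hmem, hnd.idxOf_getElem]

theorem finrank_heightIdeal (hs : Supported h) (hb : BorelHeights h) :
    Module.finrank ℂ (Poly ⧸ heightIdeal h) =
      ∑ q ∈ Finset.range 3 ×ˢ Finset.range 4, h q.1 q.2 := by
  rw [finrank_quotient (isMonomialIdeal_heightIdeal hb)]
  refine card_standard (below_iff_heightIdeal hb) _ fun a b hab => ?_
  by_contra hn
  simp only [Finset.mem_product, Finset.mem_range] at hn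
  exact hab (hs a b (by omega))

theorem tmaxEq_two : TmaxEq 14 2 64 := by
  constructor
  · have hs := supported_ht 6 3 1 0 3 1 0 0 0
    have hb := borelHeights_of_supported hs (by decide)
    have hh := below_iff_heightIdeal hb
    refine ⟨heightIdeal (ht 6 3 1 0 3 1 0 0 0), isMonomialIdeal_heightIdeal hb,
      isBorelFixed_heightIdeal hb, (finrank_heightIdeal hs hb).trans (by decide),
      (X_pow_mem_iff hh 2).2 rfl, fun hx => ?_, le_antisymm ?_ ?_⟩
    · exact absurd ((X_pow_mem_iff hh 1).1 hx) (by decide)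
    · have := le_tangentDim_heightIdeal hs hb (by decide +kernel) 1 (by decide +kernel)
        (by decide +kernel)
      exact le_trans (by decide +kernel) this
    · exact tangentDim_le_of_boundOK (isMonomialIdeal_heightIdeal hb) hs hh (by decide +kernel)
  · rintro t ⟨I, hI, hB, hcard, hx, -, rfl⟩
    exact (tangentDim_le_of_borel hI hB hcard (I.pow_mem_of_pow_mem hx (by norm_num))).2.1 hx

theorem tmaxEq_three : TmaxEq 14 3 78 := by
  constructor
  · have hs := supported_ht 5 3 1 0 3 1 0 1 0
    have hb := borelHeights_of_supported hs (by decide)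
    have hh := below_iff_heightIdeal hb
    refine ⟨heightIdeal (ht 5 3 1 0 3 1 0 1 0), isMonomialIdeal_heightIdeal hb,
      isBorelFixed_heightIdeal hb, (finrank_heightIdeal hs hb).trans (by decide),
      (X_pow_mem_iff hh 3).2 rfl, fun hx => ?_, le_antisymm ?_ ?_⟩
    · exact absurd ((X_pow_mem_iff hh 2).1 hx) (by decide)
    · have := le_tangentDim_heightIdeal hs hb (by decide +kernel) 1 (by decide +kernel)
        (by decide +kernel)
      exact le_trans (by decide +kernel) this
    · exact tangentDim_le_of_boundOK (isMonomialIdeal_heightIdeal hb) hs hh (by decide +kernel)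
  · rintro t ⟨I, hI, hB, hcard, hx, -, rfl⟩
    exact (tangentDim_le_of_borel hI hB hcard hx).2.2

end Examples

end HilbertTangent

theorem Tmax_monotonicity_l14 :
    TmaxEq 14 2 64 ∧
    TmaxEq 14 3 78 ∧
    (∀ T1 T2 T3 : ℕ, TmaxEq 14 1 T1 → TmaxEq 14 2 T2 → TmaxEq 14 3 T3 →
      T1 < T2 ∧ T2 < T3) := by
  refine ⟨HilbertTangent.tmaxEq_two, HilbertTangent.tmaxEq_three, fun T1 T2 T3 h1 h2 h3 => ?_⟩
  obtain rfl := h2.unique HilbertTangent.tmaxEq_two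
  obtain rfl := h3.unique HilbertTangent.tmaxEq_three
  obtain ⟨I, hI, hB, hcard, hx, -, rfl⟩ := h1.1
  have := (HilbertTangent.tangentDim_le_of_borel hI hB hcard
    (I.pow_mem_of_pow_mem hx (by norm_num))).1 hx
  omega
end
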